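/- For every t ∈ [0,∞] there exists a compact metric space X with at least three points and a minimal homeomorphism T : X → X such that every self-homeomorphism of X equals T^n for some n ∈ ℤ, and the topological entropy of T equals t. -/

import Mathlib

open Set Filter Topology

/-- Integer powers (iterates) of a self-homeomorphism: `hzpow T n = Tⁿ` for `n : ℤ`. -/
def hzpow {X : Type*} [TopologicalSpace X] (T : X ≃ₜ X) : ℤ → (X ≃ₜ X)
  | Int.ofNat n => (fun S => S.trans T)^[n] (Homeomorph.refl X)
  | Int.negSucc n => ((fun S => S.trans T)^[n + 1] (Homeomorph.refl X)).symm

/-- A self-map of a topological space is minimal if every forward orbit is dense. -/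
def IsMinimal {X : Type*} [TopologicalSpace X] (T : X → X) : Prop :=
  ∀ x : X, Dense (Set.range fun n : ℕ => T^[n] x)

/-- `E` is an `(n, ε)`-separated set for the map `S`: any two distinct points of `E` are more
than `ε` apart in the dynamical metric `max_{0 ≤ j < n} dist (S^j x) (S^j y)`. -/
def IsDynSep {Z : Type*} [PseudoMetricSpace Z] (S : Z → Z) (n : ℕ) (ε : ℝ) (E : Set Z) : Prop :=
  ∀ x ∈ E, ∀ y ∈ E, x ≠ y → ∃ j < n, ε < dist (S^[j] x) (S^[j] y)

/-- The maximal cardinality `sep(n, ε; K)` of an `(n, ε)`-separated subset of `K`. -/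
noncomputable def sepNum {Z : Type*} [PseudoMetricSpace Z] (S : Z → Z) (n : ℕ) (ε : ℝ)
    (K : Set Z) : ℕ :=
  sSup {m : ℕ | ∃ E : Finset Z, ↑E ⊆ K ∧ IsDynSep S n ε ↑E ∧ E.card = m}

/-- The topological entropy of `S` on the set `K`:
`lim_{ε → 0} limsup_n (1/n) log sep(n, ε; K)`; the limit as `ε → 0` is realized as the
supremum over `ε > 0`, the quantity being monotone in `ε`. -/
noncomputable def entropyOnSet {Z : Type*} [PseudoMetricSpace Z] (S : Z → Z) (K : Set Z) :
    EReal :=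
  ⨆ (ε : ℝ) (_ : 0 < ε),
    Filter.atTop.limsup fun n : ℕ => ((Real.log (sepNum S n ε K) / n : ℝ) : EReal)

/-- The topological entropy of the restriction of `S` to a subset `A` of its domain:
the supremum of the entropies on all compact subsets of `A`. -/
noncomputable def entropyOn {Z : Type*} [PseudoMetricSpace Z] (S : Z → Z) (A : Set Z) : EReal :=
  ⨆ (K : Set Z) (_ : IsCompact K) (_ : K ⊆ A), entropyOnSet S K

/-- The topological entropy of `S`: the supremum of the entropies on all compact sets. -/
noncomputable def dynEntropy {Z : Type*} [PseudoMetricSpace Z] (S : Z → Z) : EReal :=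
  ⨆ (K : Set Z) (_ : IsCompact K), entropyOnSet S K




namespace Slov

/-- Periods of the odometer. -/
def pp : ℕ → ℕ
  | 0 => 1
  | k + 1 => pp k * (((k + 1) ^ (pp k) + 1) * (k + 2) ^ 2)

/-- Number of fill-ins at level `k`. -/
def mm (k : ℕ) : ℕ := (k + 1) ^ (pp k)

/-- Ratio of consecutive periods. -/
def qq (k : ℕ) : ℕ := (mm k + 1) * (k + 2) ^ 2

lemma pp_succ (k : ℕ) : pp (k + 1) = pp k * qq k := rfl

lemma mm_pos (k : ℕ) : 0 < mm k := by unfold mm; positivity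

lemma qq_pos (k : ℕ) : 0 < qq k := by unfold qq; positivity

lemma qq_ge (k : ℕ) : mm k + 2 ≤ qq k := by
  unfold qq
  have := mm_pos k
  have h : 4 ≤ (k + 2) ^ 2 := by nlinarith [Nat.zero_le k, sq_nonneg k]
  nlinarith

lemma pp_pos (k : ℕ) : 0 < pp k := by
  induction k with
  | zero => simp [pp]
  | succ k ih => rw [pp_succ]; exact Nat.mul_pos ih (qq_pos k)

instance (k : ℕ) : NeZero (pp k) := ⟨(pp_pos k).ne'⟩

lemma pp_dvd_succ (k : ℕ) : pp k ∣ pp (k + 1) := ⟨qq k, pp_succ k⟩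

lemma pp_lt_succ (k : ℕ) : pp k < pp (k + 1) := by
  rw [pp_succ]
  have := qq_ge k
  have := pp_pos k
  nlinarith

lemma lt_pp (k : ℕ) : k < pp k := by
  induction k with
  | zero => exact pp_pos 0
  | succ k ih => have := pp_lt_succ k; omega

lemma pp_strictMono : StrictMono pp := strictMono_nat_of_lt_succ pp_lt_succ

/-- The odometer, as a subring of the product of the `ZMod (pp k)`. -/
def OdoR : Subring (∀ k, ZMod (pp k)) where
  carrier := {κ | ∀ k, ZMod.castHom (pp_dvd_succ k) (ZMod (pp k)) (κ (k + 1)) = κ k}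
  mul_mem' := by intro a b ha hb k; simp only [mem_ofPred_eq] at *; rw [Pi.mul_apply, map_mul, ha, hb]; rfl
  one_mem' := by intro k; exact map_one _
  add_mem' := by intro a b ha hb k; simp only [mem_ofPred_eq] at *; rw [Pi.add_apply, map_add, ha, hb]; rfl
  zero_mem' := by intro k; simp
  neg_mem' := by intro a ha k; simp only [mem_ofPred_eq] at *; rw [Pi.neg_apply, map_neg, ha]; rfl

abbrev Odo : Type := OdoR

lemma Odo.compat (κ : Odo) (k : ℕ) :
    ZMod.castHom (pp_dvd_succ k) (ZMod (pp k)) (κ.1 (k + 1)) = κ.1 k := κ.2 k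

lemma isClosed_Odo : IsClosed (OdoR : Set (∀ k, ZMod (pp k))) := by
  have : (OdoR : Set (∀ k, ZMod (pp k))) =
      ⋂ k, {κ | ZMod.castHom (pp_dvd_succ k) (ZMod (pp k)) (κ (k + 1)) = κ k} := by
    ext κ; simp only [mem_iInter]; rfl
  rw [this]
  refine isClosed_iInter fun k => isClosed_eq ?_ (continuous_apply k)
  exact (continuous_of_discreteTopology).comp (continuous_apply (k + 1))

instance : CompactSpace Odo := isCompact_iff_compactSpace.mp isClosed_Odo.isCompact

/-- residue -/
def res (k : ℕ) (κ : Odo) : ℕ := (κ.1 k).val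

lemma res_lt (k : ℕ) (κ : Odo) : res k κ < pp k := ZMod.val_lt _

lemma res_succ_mod (k : ℕ) (κ : Odo) : res (k + 1) κ % pp k = res k κ := by
  unfold res
  rw [← Odo.compat κ k, ZMod.castHom_apply, ZMod.cast_eq_val, ZMod.val_natCast]

lemma coord_add_int (κ : Odo) (m : ℤ) (k : ℕ) : (κ + (m : Odo)).1 k = κ.1 k + (m : ZMod (pp k)) := by
  simp

lemma coord_int (m : ℤ) (k : ℕ) : ((m : Odo)).1 k = (m : ZMod (pp k)) := by
  simp

lemma eq_of_le {κ κ' : Odo} {K k : ℕ} (h : κ.1 K = κ'.1 K) (hk : k ≤ K) : κ.1 k = κ'.1 k := by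
  induction K, hk using Nat.le_induction with
  | base => exact h
  | succ n hn ih =>
    apply ih
    rw [← Odo.compat κ n, ← Odo.compat κ' n, h]

/-- the digit -/
def dig (k : ℕ) (κ : Odo) : ℕ := res (k + 1) κ / pp k

lemma dig_lt (k : ℕ) (κ : Odo) : dig k κ < qq k := by
  unfold dig
  rw [Nat.div_lt_iff_lt_mul (pp_pos k)]
  have := res_lt (k + 1) κ
  rw [pp_succ] at this
  linarith

lemma res_succ_eq (k : ℕ) (κ : Odo) : res (k + 1) κ = dig k κ * pp k + res k κ := by
  rw [← res_succ_mod k κ]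
  unfold dig
  exact (Nat.div_add_mod' _ _).symm

/-- bad digits: the position is determined at level `k` -/
def Bad (k : ℕ) (κ : Odo) : Prop := dig k κ < mm k ∨ dig k κ + 1 = qq k

/-- first bad -/
def FB (k : ℕ) (κ : Odo) : Prop := Bad k κ ∧ ∀ j < k, ¬ Bad j κ

lemma FB.unique {k l : ℕ} {κ : Odo} (h : FB k κ) (h' : FB l κ) : k = l := by
  rcases lt_trichotomy k l with hl | hl | hl
  · exact absurd h.1 (h'.2 k hl)
  · exact hl
  · exact absurd h'.1 (h.2 l hl)

lemma FB_of_bad {k : ℕ} {κ : Odo} (h : Bad k κ) : ∃ l ≤ k, FB l κ := by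
  classical
  have hex : ∃ k, Bad k κ := ⟨k, h⟩
  exact ⟨Nat.find hex, Nat.find_min' hex h, Nat.find_spec hex, fun j hj => Nat.find_min hex hj⟩

lemma res_congr {κ κ' : Odo} {K k : ℕ} (h : κ.1 K = κ'.1 K) (hk : k ≤ K) : res k κ = res k κ' := by
  unfold res; rw [eq_of_le h hk]

lemma dig_congr {κ κ' : Odo} {K k : ℕ} (h : κ.1 K = κ'.1 K) (hk : k < K) : dig k κ = dig k κ' := by
  unfold dig; rw [res_congr h hk]

lemma Bad_congr {κ κ' : Odo} {K k : ℕ} (h : κ.1 K = κ'.1 K) (hk : k < K) : Bad k κ ↔ Bad k κ' := by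
  unfold Bad; rw [dig_congr h hk]

lemma FB_congr {κ κ' : Odo} {K k : ℕ} (h : κ.1 K = κ'.1 K) (hk : k < K) : FB k κ ↔ FB k κ' := by
  unfold FB
  rw [Bad_congr h hk]
  refine and_congr_right fun _ => forall_congr' fun j => ?_
  refine imp_congr_right fun hj => ?_
  rw [Bad_congr h (hj.trans hk)]

section val
variable {A : Type}

open Classical in
/-- the determined value -/
noncomputable def bv (a : ℕ → A) (k : ℕ) (κ : Odo) : A :=
  if h : dig k κ < mm k then
    a ((finFunctionFinEquiv.symm (⟨dig k κ, h⟩ : Fin ((k + 1) ^ pp k)) :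
      Fin (pp k) → Fin (k + 1)) ⟨res k κ, res_lt k κ⟩)
  else a 0

lemma bv_congr (a : ℕ → A) {κ κ' : Odo} {K k : ℕ} (h : κ.1 K = κ'.1 K) (hk : k < K) :
    bv a k κ = bv a k κ' := by
  unfold bv
  have h1 := dig_congr h hk
  have h2 := res_congr h hk.le
  simp only [h1, h2]

lemma res_int_nonneg {k : ℕ} {n : ℤ} (h0 : 0 ≤ n) (h : n < pp k) : (res k (n : Odo) : ℤ) = n := by
  unfold res
  rw [coord_int, ZMod.val_intCast, Int.emod_eq_of_lt h0 h]

lemma res_int_neg {k : ℕ} {n : ℤ} (h0 : n < 0) (h : -(pp k : ℤ) ≤ n) :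
    (res k (n : Odo) : ℤ) = pp k + n := by
  unfold res
  rw [coord_int, ZMod.val_intCast, ← Int.add_emod_left, Int.emod_eq_of_lt (by omega) (by omega)]

lemma exists_bad_int (n : ℤ) : ∃ k, Bad k (n : Odo) := by
  rcases le_or_gt 0 n with h | h
  · obtain ⟨m, rfl⟩ := Int.eq_ofNat_of_zero_le h
    refine ⟨m, Or.inl ?_⟩
    have h1 : (m : ℤ) < pp (m + 1) := by exact_mod_cast (lt_pp m).trans (pp_lt_succ m)
    have := res_int_nonneg h h1
    have h2 : res (m + 1) ((m : ℤ) : Odo) = m := by exact_mod_cast this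
    unfold dig
    rw [h2, Nat.div_eq_of_lt (lt_pp m)]
    exact mm_pos m
  · obtain ⟨m, hm⟩ := Int.eq_ofNat_of_zero_le (neg_pos.mpr h).le
    obtain rfl : n = -(m : ℤ) := by omega
    refine ⟨m, Or.inr ?_⟩
    have hl := lt_pp m
    have hq := qq_ge m
    have h1 : -(pp (m + 1) : ℤ) ≤ -(m : ℤ) := by
      have := pp_lt_succ m; omega
    have := res_int_neg h h1
    unfold dig
    have h2 : res (m + 1) ((-(m : ℤ) : ℤ) : Odo) = (pp m - m) + (qq m - 1) * pp m := by
      have h3 : pp (m + 1) = pp m + (qq m - 1) * pp m := by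
        rw [pp_succ]
        obtain ⟨t, ht⟩ : ∃ t, qq m = t + 1 := ⟨qq m - 1, by omega⟩
        rw [ht]; simp; ring
      omega
    rw [h2, Nat.add_mul_div_right _ _ (pp_pos m), Nat.div_eq_of_lt (by omega)]
    omega

lemma exists_FB_int (n : ℤ) : ∃ k, FB k (n : Odo) := by
  obtain ⟨k, hk⟩ := exists_bad_int n
  obtain ⟨l, _, hl⟩ := FB_of_bad hk
  exact ⟨l, hl⟩

/-- the Toeplitz sequence -/
noncomputable def zz (a : ℕ → A) (n : ℤ) : A := bv a (exists_FB_int n).choose (n : Odo)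

lemma zz_eq (a : ℕ → A) {n : ℤ} {k : ℕ} (h : FB k (n : Odo)) : zz a n = bv a k n := by
  unfold zz
  rw [(exists_FB_int n).choose_spec.unique h]

/-- The symbolic condition. -/
def Sym (a : ℕ → A) (κ : Odo) (x : ℤ → A) : Prop :=
  ∀ (n : ℤ) (k : ℕ), FB k (κ + (n : Odo)) → x n = bv a k (κ + (n : Odo))

lemma Sym_zz (a : ℕ → A) (m : ℤ) : Sym a (m : Odo) (fun n => zz a (m + n)) := by
  intro n k h
  have e : (m : Odo) + (n : Odo) = ((m + n : ℤ) : Odo) := by push_cast; rfl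
  rw [e] at h ⊢
  exact zz_eq a h

lemma Sym_int_unique (a : ℕ → A) {m : ℤ} {x : ℤ → A} (h : Sym a (m : Odo) x) :
    x = fun n => zz a (m + n) := by
  funext n
  obtain ⟨k, hk⟩ := exists_FB_int (m + n)
  have e : (m : Odo) + (n : Odo) = ((m + n : ℤ) : Odo) := by push_cast; rfl
  rw [zz_eq a hk, ← e]
  rw [← e] at hk
  exact h n k hk

lemma Sym_shift (a : ℕ → A) {κ : Odo} {x : ℤ → A} (h : Sym a κ x) (m : ℤ) :
    Sym a (κ + (m : Odo)) (fun n => x (n + m)) := by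
  intro n k hk
  have e : κ + (m : Odo) + (n : Odo) = κ + ((n + m : ℤ) : Odo) := by push_cast; ring
  rw [e] at hk ⊢
  exact h _ _ hk

lemma odo_int_inj {m n : ℤ} (h : (m : Odo) = (n : Odo)) : m = n := by
  have h1 : ∀ k, ((m : ℤ) : ZMod (pp k)) = (n : ZMod (pp k)) := fun k => by
    rw [← coord_int, ← coord_int, h]
  have h2 := h1 (m - n).natAbs
  rw [ZMod.intCast_eq_intCast_iff_dvd_sub] at h2
  have h3 := lt_pp (m - n).natAbs
  by_contra hne
  have h4 := Int.natAbs_dvd_natAbs.mpr h2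
  have h5 := Nat.le_of_dvd (by omega) h4
  simp only [Int.natAbs_natCast] at h5
  omega

lemma int_of_bounded {κ : Odo} {M : ℕ} (h : ∀ k, res k κ < M) : κ = ((res M κ : ℤ) : Odo) := by
  have h1 : ∀ k, M ≤ k → res k κ = res M κ := by
    intro k hk
    induction k, hk using Nat.le_induction with
    | base => rfl
    | succ n hn ih =>
      rw [← ih, ← res_succ_mod n κ, Nat.mod_eq_of_lt]
      exact (h (n + 1)).trans (hn.trans_lt (lt_pp n))
  have h2 : ∀ k, M ≤ k → κ.1 k = ((res M κ : ℤ) : Odo).1 k := by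
    intro k hk
    rw [coord_int, ← h1 k hk]
    simp [res]
  apply Subtype.ext
  funext k
  rcases le_total M k with hk | hk
  · exact h2 k hk
  · exact eq_of_le (h2 M le_rfl) hk

lemma res_mono (κ : Odo) : Monotone (fun k => res k κ) := by
  refine monotone_nat_of_le_succ fun k => ?_
  rw [← res_succ_mod k κ]
  exact Nat.mod_le _ _

lemma cores_mono (κ : Odo) : Monotone (fun k => pp k - res k κ) := by
  refine monotone_nat_of_le_succ fun k => ?_
  have h1 := res_succ_eq k κ
  have h2 := dig_lt k κ
  have h3 := res_lt k κ
  have h4 : dig k κ * pp k + pp k ≤ pp (k + 1) := by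
    rw [pp_succ]
    have : (dig k κ + 1) * pp k ≤ qq k * pp k := Nat.mul_le_mul_right _ h2
    linarith
  omega

lemma exists_central {κ : Odo} (h : ∀ m : ℤ, κ ≠ (m : Odo)) (M : ℕ) :
    ∃ K, ∀ k, K ≤ k → M ≤ res k κ ∧ res k κ + M < pp k := by
  have h1 : ∃ k, M ≤ res k κ := by
    by_contra hc
    push Not at hc
    exact h _ (int_of_bounded hc)
  have h2 : ∃ k, M + 1 ≤ pp k - res k κ := by
    by_contra hc
    push Not at hc
    have : ∀ k, res k (-κ) < M + 1 := by
      intro k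
      have e : res k (-κ) = (-(κ.1 k)).val := rfl
      rw [e, ZMod.neg_val]
      split_ifs
      · omega
      · exact hc k
    have h3 := int_of_bounded this
    refine h (-(res (M + 1) (-κ) : ℤ)) ?_
    push_cast at h3 ⊢
    rw [← h3, neg_neg]
  obtain ⟨k1, hk1⟩ := h1
  obtain ⟨k2, hk2⟩ := h2
  refine ⟨max k1 k2, fun k hk => ?_⟩
  have h3 : res k1 κ ≤ res k κ := res_mono κ ((le_max_left _ _).trans hk)
  have h4 : pp k2 - res k2 κ ≤ pp k - res k κ := cores_mono κ ((le_max_right _ _).trans hk)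
  omega

lemma res_add_int {κ : Odo} {k : ℕ} {n : ℤ} (h0 : 0 ≤ (res k κ : ℤ) + n) (h1 : (res k κ : ℤ) + n < pp k) :
    (res k (κ + (n : Odo)) : ℤ) = res k κ + n := by
  unfold res at *
  have e : (κ + (n : Odo)).1 k = (((κ.1 k).val + n : ℤ) : ZMod (pp k)) := by
    rw [coord_add_int]; push_cast; simp
  rw [e, ZMod.val_intCast, Int.emod_eq_of_lt h0 h1]

variable [TopologicalSpace A]

lemma zz_dense {a : ℕ → A} (ha : DenseRange a) {κ : Odo} {x : ℤ → A} (hx : Sym a κ x) (K0 M : ℕ)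
    (U : ℤ → Set A) (hU : ∀ n, IsOpen (U n)) (hxU : ∀ n, x n ∈ U n) :
    ∃ m : ℤ, (m : Odo).1 K0 = κ.1 K0 ∧ ∀ n : ℤ, |n| ≤ M → zz a (m + n) ∈ U n := by
  by_cases hκ : ∃ m : ℤ, κ = (m : Odo)
  · obtain ⟨m, rfl⟩ := hκ
    refine ⟨m, rfl, fun n _ => ?_⟩
    have := Sym_int_unique a hx
    have h2 := hxU n
    rw [this] at h2
    exact h2
  push Not at hκ
  have hap : ∀ n : ℤ, ∃ i : ℕ, a i ∈ U n := fun n => ha.exists_mem_open (hU n) ⟨_, hxU n⟩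
  choose f hf using hap
  obtain ⟨K1, hK1⟩ := exists_central hκ M
  obtain ⟨K2, hK2⟩ : ∃ K2, ∀ n ∈ Finset.Icc (-(M : ℤ)) M, f n ≤ K2 :=
    ⟨(Finset.Icc (-(M : ℤ)) M).sup f, fun n hn => Finset.le_sup hn⟩
  obtain ⟨K, hk0, hk1, hk2⟩ : ∃ K, K0 ≤ K ∧ K1 ≤ K ∧ K2 ≤ K := ⟨K0 + K1 + K2, by omega, by omega, by omega⟩
  obtain ⟨hc1, hc2⟩ := hK1 K hk1
  let φ : Fin (pp K) → Fin (K + 1) := fun j =>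
    ⟨min (f ((j : ℤ) - res K κ)) K, by omega⟩
  let i : Fin ((K + 1) ^ pp K) := finFunctionFinEquiv φ
  let m : ℤ := ((i : ℕ) * pp K + res K κ : ℕ)
  have hi : (i : ℕ) < mm K := i.2
  have hmK : (m : Odo).1 K = κ.1 K := by
    rw [coord_int]
    simp [m, res]
  refine ⟨m, eq_of_le hmK hk0, fun n hn => ?_⟩
  rw [abs_le] at hn
  have hmn : ((m + n : ℤ) : Odo).1 K = (κ + (n : Odo)).1 K := by
    rw [coord_add_int, coord_int, Int.cast_add, ← coord_int m K, hmK]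
  have hres : (res K (κ + (n : Odo)) : ℤ) = res K κ + n := res_add_int (by omega) (by omega)
  have hresm : res K ((m + n : ℤ) : Odo) = res K (κ + (n : Odo)) := res_congr hmn le_rfl
  have hlt : (m + n : ℤ) < pp (K + 1) := by
    have h1 : ((i : ℕ) + 1) * pp K ≤ qq K * pp K :=
      Nat.mul_le_mul_right _ (by have := qq_ge K; omega)
    have h2 : pp (K + 1) = qq K * pp K := by rw [pp_succ, mul_comm]
    have h3 : m = (i : ℕ) * pp K + res K κ := by simp [m]
    rw [h2, h3]
    zify at h1
    push_cast
    nlinarith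
  have hge : (0 : ℤ) ≤ m + n := by
    have h3 : m = (i : ℕ) * pp K + res K κ := by simp [m]
    have : (0 : ℤ) ≤ (i : ℕ) * pp K := by positivity
    omega
  have hr1 := res_int_nonneg hge hlt
  have hdig : dig K ((m + n : ℤ) : Odo) = i := by
    have h4 : res (K + 1) ((m + n : ℤ) : Odo) = res K (κ + (n : Odo)) + i * pp K := by
      apply Nat.cast_injective (R := ℤ)
      beta_reduce
      rw [hr1, Nat.cast_add, hres]
      simp only [m]
      push_cast
      ring
    unfold dig
    rw [h4, Nat.add_mul_div_right _ _ (pp_pos K), Nat.div_eq_of_lt (res_lt _ _), zero_add]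
  have hbad : Bad K ((m + n : ℤ) : Odo) := Or.inl (by rw [hdig]; exact hi)
  obtain ⟨l, hl, hFB⟩ := FB_of_bad hbad
  rw [zz_eq a hFB]
  rcases hl.lt_or_eq with hl | rfl
  · have h5 := (FB_congr hmn hl).mp hFB
    rw [bv_congr a hmn hl, ← hx n l h5]
    exact hxU n
  · unfold bv
    have h6 : dig l ((m + n : ℤ) : Odo) < mm l := by rw [hdig]; exact hi
    rw [dif_pos h6]
    have h7 : (⟨dig l ((m + n : ℤ) : Odo), h6⟩ : Fin ((l + 1) ^ pp l)) = i := Fin.ext hdig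
    rw [h7]
    simp only [i, Equiv.symm_apply_apply, φ]
    rw [hresm, hres, add_sub_cancel_left, min_eq_left]
    · exact hf n
    · exact (hK2 n (by simp; omega)).trans hk2

end val
end Slov


namespace Slov

/-- the coordinate on the `k`-th circle -/
noncomputable def tc (k : ℕ) (κ : Odo) (r : ℝ) : UnitAddCircle :=
  ZMod.toAddCircle (κ.1 k) + ((r / pp k : ℝ) : UnitAddCircle)

lemma norm_circle_le (x : UnitAddCircle) : ‖x‖ ≤ 1 / 2 := by
  have := AddCircle.norm_le_half_period (1 : ℝ) (x := x) one_ne_zero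
  simpa using this

lemma norm_coe_circle_le (x : ℝ) : ‖(x : UnitAddCircle)‖ ≤ |x| := by
  rw [UnitAddCircle.norm_eq]
  simpa using round_le x 0

lemma tc_shift (k : ℕ) (κ : Odo) (r : ℝ) (m : ℤ) : tc k (κ + (m : Odo)) (r - m) = tc k κ r := by
  unfold tc
  rw [coord_add_int, map_add, ZMod.toAddCircle_intCast, add_assoc, ← AddCircle.coe_add]
  congr 3
  ring

lemma tc_diff {κ κ' : Odo} {k : ℕ} (h : κ.1 k = κ'.1 k) (r r' : ℝ) :
    |‖tc k κ r‖ - ‖tc k κ' r'‖| ≤ |r - r'| := by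
  refine (abs_norm_sub_norm_le _ _).trans ?_
  unfold tc
  rw [h, add_sub_add_left_eq_sub, ← AddCircle.coe_sub, ← sub_div]
  refine (norm_coe_circle_le _).trans ?_
  rw [abs_div]
  have : (1 : ℝ) ≤ |(pp k : ℝ)| := by
    rw [abs_of_nonneg (by positivity)]
    exact_mod_cast pp_pos k
  exact div_le_self (abs_nonneg _) this

/-- distance-like function to the singular point -/
noncomputable def DD (κ : Odo) (r : ℝ) : ℝ := ∑' k, (1 / 2 : ℝ) ^ k * ‖tc k κ r‖

lemma summable_DD (κ : Odo) (r : ℝ) : Summable fun k => (1 / 2 : ℝ) ^ k * ‖tc k κ r‖ := by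
  refine Summable.of_nonneg_of_le (fun k => by positivity) (fun k => ?_) summable_geometric_two
  have := norm_circle_le (tc k κ r)
  have h2 : (0 : ℝ) ≤ (1 / 2) ^ k := by positivity
  nlinarith

lemma DD_nonneg (κ : Odo) (r : ℝ) : 0 ≤ DD κ r := tsum_nonneg fun k => by positivity

lemma DD_ge (κ : Odo) (r : ℝ) (k : ℕ) : (1 / 2 : ℝ) ^ k * ‖tc k κ r‖ ≤ DD κ r :=
  (summable_DD κ r).le_tsum k fun j _ => by positivity

lemma DD_le (κ : Odo) (r : ℝ) : DD κ r ≤ 2 := by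
  rw [← tsum_geometric_two]
  refine (summable_DD κ r).tsum_le_tsum (fun k => ?_) summable_geometric_two
  have := norm_circle_le (tc k κ r)
  have h2 : (0 : ℝ) ≤ (1 / 2) ^ k := by positivity
  nlinarith

lemma DD_shift (κ : Odo) (r : ℝ) (m : ℤ) : DD (κ + (m : Odo)) (r - m) = DD κ r := by
  unfold DD
  simp_rw [tc_shift]

lemma DD_eq_zero {κ : Odo} {r : ℝ} : DD κ r = 0 ↔ ∃ m : ℤ, κ = (m : Odo) ∧ r = -m := by
  constructor
  · intro h
    have h0 : ∀ k, tc k κ r = 0 := by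
      intro k
      have h1 := DD_ge κ r k
      rw [h] at h1
      have h2 : (0 : ℝ) < (1 / 2) ^ k := by positivity
      have h3 : ‖tc k κ r‖ ≤ 0 := by
        by_contra hc
        push Not at hc
        have := mul_pos h2 hc
        linarith
      exact norm_le_zero_iff.mp h3
    have h1 := h0 0
    have hz : κ.1 0 = 0 := by
      have : Subsingleton (ZMod (pp 0)) := by
        change Subsingleton (ZMod 1); infer_instance
      exact Subsingleton.elim _ _
    unfold tc at h1
    rw [hz, map_zero, zero_add, AddCircle.coe_eq_zero_iff] at h1
    obtain ⟨n, hn⟩ := h1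
    have hr : r = n := by simp [pp] at hn; exact hn.symm
    refine ⟨-n, ?_, by rw [hr]; push_cast; ring⟩
    apply Subtype.ext
    funext k
    have h2 := h0 k
    unfold tc at h2
    rw [hr, ← ZMod.toAddCircle_intCast, ← map_add, ZMod.toAddCircle_eq_zero] at h2
    rw [coord_int, Int.cast_neg]
    exact eq_neg_of_add_eq_zero_left h2
  · rintro ⟨m, rfl, rfl⟩
    have h1 : ∀ k, tc k (m : Odo) (-m) = 0 := by
      intro k
      unfold tc
      rw [coord_int, ZMod.toAddCircle_intCast, ← AddCircle.coe_add, neg_div, add_neg_cancel]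
      simp
    unfold DD
    simp [h1]

lemma DD_unif {κ κ' : Odo} {K : ℕ} (h : κ.1 K = κ'.1 K) (r r' : ℝ) :
    |DD κ r - DD κ' r'| ≤ 2 * |r - r'| + 4 * (2 / 3 : ℝ) ^ K := by
  have s1 : Summable fun k : ℕ => (1 / 2 : ℝ) ^ k * |r - r'| := summable_geometric_two.mul_right _
  have hg : Summable fun k : ℕ => (3 / 4 : ℝ) ^ k :=
    summable_geometric_of_lt_one (by norm_num) (by norm_num)
  have s2 : Summable fun k : ℕ => (3 / 4 : ℝ) ^ k * (2 / 3 : ℝ) ^ K := hg.mul_right _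
  have e : 2 * |r - r'| + 4 * (2 / 3 : ℝ) ^ K =
      ∑' k : ℕ, ((1 / 2 : ℝ) ^ k * |r - r'| + (3 / 4 : ℝ) ^ k * (2 / 3 : ℝ) ^ K) := by
    rw [s1.tsum_add s2, tsum_mul_right, tsum_mul_right, tsum_geometric_two,
      tsum_geometric_of_lt_one (by norm_num) (by norm_num)]
    norm_num
  rw [e]
  unfold DD
  rw [← (summable_DD κ r).tsum_sub (summable_DD κ' r')]
  have key : ∀ k : ℕ, ‖(1 / 2 : ℝ) ^ k * ‖tc k κ r‖ - (1 / 2 : ℝ) ^ k * ‖tc k κ' r'‖‖ ≤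
      (1 / 2 : ℝ) ^ k * |r - r'| + (3 / 4 : ℝ) ^ k * (2 / 3 : ℝ) ^ K := by
    intro k
    rw [← mul_sub, norm_mul, Real.norm_eq_abs, Real.norm_eq_abs, abs_of_nonneg (by positivity)]
    have hp : (0 : ℝ) ≤ (1 / 2) ^ k := by positivity
    have hq : (0 : ℝ) ≤ (3 / 4 : ℝ) ^ k * (2 / 3 : ℝ) ^ K := by positivity
    rcases le_total k K with hk | hk
    · have := mul_le_mul_of_nonneg_left (tc_diff (eq_of_le h hk) r r') hp
      linarith
    · have h1 : |‖tc k κ r‖ - ‖tc k κ' r'‖| ≤ 1 := by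
        have a1 := norm_circle_le (tc k κ r)
        have a2 := norm_circle_le (tc k κ' r')
        have a3 := norm_nonneg (tc k κ r)
        have a4 := norm_nonneg (tc k κ' r')
        rw [abs_le]; constructor <;> linarith
      have h2 : (1 / 2 : ℝ) ^ k ≤ (3 / 4 : ℝ) ^ k * (2 / 3 : ℝ) ^ K := by
        have e1 : (1 / 2 : ℝ) ^ k = (3 / 4 : ℝ) ^ k * (2 / 3 : ℝ) ^ k := by
          rw [← mul_pow]; norm_num
        rw [e1]
        refine mul_le_mul_of_nonneg_left ?_ (by positivity)
        exact pow_le_pow_of_le_one (by norm_num) (by norm_num) hk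
      have h3 := mul_le_mul_of_nonneg_left h1 hp
      have h4 : 0 ≤ (1 / 2 : ℝ) ^ k * |r - r'| := by positivity
      linarith
  have := tsum_of_norm_bounded (s1.add s2).hasSum key
  exact this

lemma DD_unif' {ε : ℝ} (hε : 0 < ε) : ∃ K : ℕ, ∃ δ > 0, ∀ (κ κ' : Odo) (r r' : ℝ),
    κ.1 K = κ'.1 K → |r - r'| < δ → |DD κ r - DD κ' r'| < ε := by
  obtain ⟨K, hK⟩ := exists_pow_lt_of_lt_one (show (0 : ℝ) < ε / 8 by positivity)
    (show (2 / 3 : ℝ) < 1 by norm_num)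
  refine ⟨K, ε / 4, by positivity, fun κ κ' r r' h hr => ?_⟩
  have := DD_unif h r r'
  linarith

lemma isOpen_coord (κ : Odo) (K : ℕ) : {κ' : Odo | κ'.1 K = κ.1 K} ∈ 𝓝 κ := by
  have hc : Continuous fun κ' : Odo => κ'.1 K := (continuous_apply K).comp continuous_subtype_val
  have ho : IsOpen {κ' : Odo | κ'.1 K = κ.1 K} := (isOpen_discrete {κ.1 K}).preimage hc
  exact ho.mem_nhds rfl

lemma continuous_DD : Continuous fun p : Odo × ℝ => DD p.1 p.2 := by
  rw [continuous_iff_continuousAt]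
  rintro ⟨κ, r⟩
  rw [ContinuousAt, Metric.tendsto_nhds]
  intro ε hε
  obtain ⟨K, δ, hδ, H⟩ := DD_unif' hε
  filter_upwards [prod_mem_nhds (isOpen_coord κ K) (Metric.ball_mem_nhds r hδ)]
  rintro ⟨κ', r'⟩ ⟨h1, h2⟩
  exact H κ' κ r' r h1 h2

/-- constant -/
noncomputable def CC : ℝ := ∑' k : ℕ, (1 / 2 : ℝ) ^ k * (1 / pp k)

lemma CC_term (k : ℕ) : (1 / 2 : ℝ) ^ k * (1 / pp k) ≤ (1 / 2 : ℝ) ^ k := by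
  have : (1 : ℝ) ≤ pp k := by exact_mod_cast pp_pos k
  have h : (1 : ℝ) / pp k ≤ 1 := by rw [div_le_one (by positivity)]; exact this
  have h2 : (0 : ℝ) ≤ (1 / 2) ^ k := by positivity
  nlinarith

lemma summable_CC : Summable fun k : ℕ => (1 / 2 : ℝ) ^ k * (1 / pp k) :=
  Summable.of_nonneg_of_le (fun k => by positivity) CC_term summable_geometric_two

lemma CC_le : CC ≤ 2 := by
  rw [← tsum_geometric_two]
  exact summable_CC.tsum_le_tsum CC_term summable_geometric_two

lemma CC_pos : 0 < CC := by
  have h1 := summable_CC.le_tsum 0 (fun j _ => by positivity)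
  have e : (1 / 2 : ℝ) ^ 0 * (1 / pp 0) = 1 := by simp [pp]
  rw [e] at h1
  have h2 : (1 : ℝ) ≤ CC := h1
  linarith

lemma DD_zero {r : ℝ} (h : |r| ≤ 1 / 2) : DD 0 r = CC * |r| := by
  unfold DD CC
  rw [← tsum_mul_right]
  congr 1
  funext k
  have e : tc k 0 r = ((r / pp k : ℝ) : UnitAddCircle) := by
    unfold tc
    have : (0 : Odo).1 k = 0 := rfl
    rw [this, map_zero, zero_add]
  have h1 : (1 : ℝ) ≤ pp k := by exact_mod_cast pp_pos k
  have h2 : |r / pp k| ≤ 1 / 2 := by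
    rw [abs_div, abs_of_nonneg (show (0 : ℝ) ≤ pp k by positivity)]
    exact (div_le_self (abs_nonneg _) h1).trans h
  rw [e, (AddCircle.norm_coe_eq_abs_iff (1 : ℝ) one_ne_zero).mpr (by simpa using h2), abs_div,
    abs_of_nonneg (show (0 : ℝ) ≤ pp k by positivity)]
  ring

/-- one-sided bump -/
noncomputable def bb (r : ℝ) : ℝ := max 0 (‖((r + 1 / 4 : ℝ) : UnitAddCircle)‖ - 1 / 4)

lemma bb_nonneg (r : ℝ) : 0 ≤ bb r := le_max_left _ _

lemma bb_le (r : ℝ) : bb r ≤ 1 := by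
  have := norm_circle_le ((r + 1 / 4 : ℝ) : UnitAddCircle)
  unfold bb
  exact max_le (by norm_num) (by linarith)

lemma bb_shift (r : ℝ) (m : ℤ) : bb (r - m) = bb r := by
  unfold bb
  have : ((r - m + 1 / 4 : ℝ) : UnitAddCircle) = ((r + 1 / 4 : ℝ) : UnitAddCircle) := by
    have e : r - m + 1 / 4 = (r + 1 / 4) - m := by ring
    have e2 : ((m : ℝ) : UnitAddCircle) = 0 := by
      rw [AddCircle.coe_eq_zero_iff]
      exact ⟨m, by simp⟩
    rw [e, AddCircle.coe_sub, e2, sub_zero]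
  rw [this]

lemma bb_lip (r r' : ℝ) : |bb r - bb r'| ≤ |r - r'| := by
  unfold bb
  rw [max_comm 0, max_comm 0]
  refine (abs_max_sub_max_le_abs _ _ _).trans ?_
  rw [sub_sub_sub_cancel_right]
  refine (abs_norm_sub_norm_le _ _).trans ?_
  rw [← AddCircle.coe_sub]
  refine (norm_coe_circle_le _).trans ?_
  ring_nf
  exact le_rfl

lemma bb_eq {r : ℝ} (h : |r| ≤ 1 / 4) : bb r = max 0 r := by
  rw [abs_le] at h
  unfold bb
  have h2 : |r + 1 / 4| ≤ 1 / 2 := by rw [abs_le]; constructor <;> linarith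
  rw [(AddCircle.norm_coe_eq_abs_iff (1 : ℝ) one_ne_zero).mpr (by simpa using h2),
    abs_of_nonneg (by linarith)]
  ring_nf

/-- the profile -/
noncomputable def FF (p : ℝ × ℝ) : ℝ := min 1 (2 * p.2 / p.1) * Real.sin (1 / p.1) ^ 2

lemma continuousOn_FF : ContinuousOn FF {p | p.1 ≠ 0} := by
  unfold FF
  have h1 : ContinuousOn (fun p : ℝ × ℝ => p.1) {p | p.1 ≠ 0} := continuous_fst.continuousOn
  have h2 : ContinuousOn (fun p : ℝ × ℝ => 2 * p.2) {p | p.1 ≠ 0} := by fun_prop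
  refine ContinuousOn.mul ?_ ?_
  · exact continuousOn_const.inf (h2.div h1 fun p hp => hp)
  · refine ContinuousOn.pow ?_ 2
    exact Real.continuous_sin.comp_continuousOn (continuousOn_const.div h1 fun p hp => hp)

/-- the oscillating function -/
noncomputable def gg (κ : Odo) (r : ℝ) : ℝ := FF (DD κ r, bb r)

lemma gg_mem (κ : Odo) (r : ℝ) : gg κ r ∈ Icc (0 : ℝ) 1 := by
  unfold gg FF
  have h1 : 0 ≤ 2 * bb r / DD κ r := div_nonneg (by have := bb_nonneg r; linarith) (DD_nonneg _ _)
  have h2 : 0 ≤ min 1 (2 * bb r / DD κ r) := le_min zero_le_one h1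
  have h3 : min 1 (2 * bb r / DD κ r) ≤ 1 := min_le_left _ _
  have h4 := Real.sin_sq_le_one (1 / DD κ r)
  have h5 := sq_nonneg (Real.sin (1 / DD κ r))
  exact ⟨mul_nonneg h2 h5, mul_le_one₀ h3 h5 h4⟩

lemma gg_shift (κ : Odo) (r : ℝ) (m : ℤ) : gg (κ + (m : Odo)) (r - m) = gg κ r := by
  unfold gg
  rw [DD_shift, bb_shift]

lemma continuous_bb : Continuous bb := by
  have : LipschitzWith 1 bb := LipschitzWith.of_dist_le_mul fun x y => by
    simpa [Real.dist_eq] using bb_lip x y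
  exact this.continuous

lemma continuousAt_gg {κ : Odo} {r : ℝ} (h : DD κ r ≠ 0) :
    ContinuousAt (fun p : Odo × ℝ => gg p.1 p.2) (κ, r) := by
  unfold gg
  have h1 : ContinuousAt FF (DD κ r, bb r) :=
    continuousOn_FF.continuousAt ((isOpen_ne.preimage continuous_fst).mem_nhds h)
  have h2 : ContinuousAt (fun p : Odo × ℝ => (DD p.1 p.2, bb p.2)) (κ, r) :=
    (continuous_DD.prodMk (continuous_bb.comp continuous_snd)).continuousAt
  exact ContinuousAt.comp (f := fun p : Odo × ℝ => (DD p.1 p.2, bb p.2)) (g := FF) h1 h2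

lemma gg_unif {η ε : ℝ} (hη : 0 < η) (hε : 0 < ε) : ∃ K : ℕ, ∃ δ > 0, ∀ (κ κ' : Odo) (r r' : ℝ),
    κ.1 K = κ'.1 K → |r - r'| < δ → η ≤ DD κ r → η ≤ DD κ' r' → |gg κ r - gg κ' r'| < ε := by
  have hc : IsCompact (Icc η 2 ×ˢ Icc (0 : ℝ) 1) := isCompact_Icc.prod isCompact_Icc
  have hu := hc.uniformContinuousOn_of_continuous (continuousOn_FF.mono (by
    rintro ⟨d, b⟩ ⟨h1, _⟩
    have : η ≤ d := h1.1
    change d ≠ 0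
    linarith))
  rw [Metric.uniformContinuousOn_iff] at hu
  obtain ⟨ρ, hρ, H⟩ := hu ε hε
  obtain ⟨K, δ, hδ, H2⟩ := DD_unif' hρ
  refine ⟨K, min δ ρ, lt_min hδ hρ, fun κ κ' r r' h hr h1 h2 => ?_⟩
  have := H (DD κ r, bb r) ⟨⟨h1, DD_le _ _⟩, bb_nonneg _, bb_le _⟩ (DD κ' r', bb r')
    ⟨⟨h2, DD_le _ _⟩, bb_nonneg _, bb_le _⟩ ?_
  · exact this
  · rw [Prod.dist_eq]
    refine max_lt ?_ ?_
    · exact H2 κ κ' r r' h (hr.trans_le (min_le_left _ _))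
    · exact (bb_lip r r').trans_lt (hr.trans_le (min_le_right _ _))

lemma gg_zero_pos {r : ℝ} (h0 : 0 < r) (h : r ≤ 1 / 4) : gg 0 r = Real.sin (1 / (CC * r)) ^ 2 := by
  unfold gg FF
  have h1 : |r| = r := abs_of_pos h0
  rw [bb_eq (by rw [h1]; exact h), DD_zero (by rw [h1]; linarith), h1, max_eq_right h0.le]
  have h2 : 1 ≤ 2 * r / (CC * r) := by
    have := CC_pos
    have := CC_le
    rw [le_div_iff₀ (by positivity)]
    nlinarith
  simp only [min_eq_left h2, one_mul]

lemma gg_zero_neg {r : ℝ} (h0 : r ≤ 0) (h : -(1 / 4) ≤ r) : gg 0 r = 0 := by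
  unfold gg FF
  rw [bb_eq (by rw [abs_le]; constructor <;> linarith), max_eq_left h0]
  simp

/-- `gg` valued in the unit interval -/
noncomputable def gI (κ : Odo) (r : ℝ) : unitInterval := ⟨gg κ r, gg_mem κ r⟩

lemma gI_shift (κ : Odo) (r : ℝ) (m : ℤ) : gI (κ + (m : Odo)) (r - m) = gI κ r :=
  Subtype.ext (gg_shift κ r m)

lemma continuousAt_gI {κ : Odo} {r : ℝ} (h : DD κ r ≠ 0) :
    ContinuousAt (fun p : Odo × ℝ => gI p.1 p.2) (κ, r) := by
  rw [Topology.IsInducing.subtypeVal.continuousAt_iff]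
  exact continuousAt_gg h

end Slov


set_option linter.unusedSectionVars false

namespace Slov

section space
variable {A : Type} [TopologicalSpace A]

/-- ambient space -/
abbrev Amb (A : Type) : Type := Odo × (ℤ → A) × ℝ × (ℤ → unitInterval)

/-- defining conditions -/
def Good (a : ℕ → A) (s : ℝ) (p : Amb A) : Prop :=
  Sym a p.1 p.2.1 ∧ ∀ n : ℤ, DD p.1 (p.2.2.1 + n * s) ≠ 0 →
    p.2.2.2 n = gI p.1 (p.2.2.1 + n * s)

lemma isClosed_Sym [T2Space A] (a : ℕ → A) : IsClosed {p : Odo × (ℤ → A) | Sym a p.1 p.2} := by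
  have e : {p : Odo × (ℤ → A) | Sym a p.1 p.2} =
      ⋂ n : ℤ, ⋂ k : ℕ, {p | FB k (p.1 + (n : Odo)) → p.2 n = bv a k (p.1 + (n : Odo))} := by
    ext p; simp only [mem_iInter]; rfl
  rw [e]
  refine isClosed_iInter fun n => isClosed_iInter fun k => ?_
  rw [← isOpen_compl_iff, isOpen_iff_mem_nhds]
  rintro ⟨κ, x⟩ hp
  have hp' : FB k (κ + (n : Odo)) ∧ x n ≠ bv a k (κ + (n : Odo)) := by
    simpa only [mem_compl_iff, mem_ofPred_eq, Classical.not_imp] using hp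
  have h2 : {x' : ℤ → A | x' n ≠ bv a k (κ + (n : Odo))} ∈ 𝓝 x :=
    (isOpen_ne.preimage (continuous_apply n)).mem_nhds hp'.2
  filter_upwards [prod_mem_nhds (isOpen_coord κ (k + 1)) h2]
  rintro ⟨κ', x'⟩ ⟨h3, h4⟩
  have h3' : (κ' + (n : Odo)).1 (k + 1) = (κ + (n : Odo)).1 (k + 1) := by
    rw [coord_add_int, coord_add_int]; congr 1
  simp only [mem_compl_iff, mem_ofPred_eq, Classical.not_imp]
  refine ⟨(FB_congr h3' (Nat.lt_succ_self k)).mpr hp'.1, ?_⟩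
  rw [bv_congr a h3' (Nat.lt_succ_self k)]
  exact h4

lemma isClosed_Good [T2Space A] (a : ℕ → A) (s : ℝ) : IsClosed {p : Amb A | Good a s p} := by
  have e : {p : Amb A | Good a s p} = {p : Amb A | Sym a p.1 p.2.1} ∩
      ⋂ n : ℤ, {p : Amb A | DD p.1 (p.2.2.1 + n * s) ≠ 0 →
        p.2.2.2 n = gI p.1 (p.2.2.1 + n * s)} := by
    ext p; simp only [mem_inter_iff, mem_iInter]; rfl
  rw [e]
  refine IsClosed.inter ?_ (isClosed_iInter fun n => ?_)
  · have hc : Continuous fun p : Amb A => (p.1, p.2.1) := by fun_prop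
    exact (isClosed_Sym a).preimage hc
  · rw [← isOpen_compl_iff, isOpen_iff_mem_nhds]
    intro p hp
    have hp' : DD p.1 (p.2.2.1 + n * s) ≠ 0 ∧ p.2.2.2 n ≠ gI p.1 (p.2.2.1 + n * s) := by
      simpa only [mem_compl_iff, mem_ofPred_eq, Classical.not_imp] using hp
    have hc : Continuous fun p : Amb A => (p.1, p.2.2.1 + n * s) := by fun_prop
    have h1 : ∀ᶠ p' in 𝓝 p, DD p'.1 (p'.2.2.1 + n * s) ≠ 0 :=
      have h0 : Continuous (fun p' : Amb A => DD p'.1 (p'.2.2.1 + n * s)) :=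
        Continuous.comp' (g := fun z : Odo × ℝ => DD z.1 z.2)
          (f := fun p' : Amb A => (p'.1, p'.2.2.1 + n * s)) continuous_DD hc
      (isOpen_ne.preimage h0).mem_nhds hp'.1
    have h2 : ContinuousAt (fun p : Amb A => gI p.1 (p.2.2.1 + n * s)) p :=
      ContinuousAt.comp' (g := fun z : Odo × ℝ => gI z.1 z.2)
        (f := fun p' : Amb A => (p'.1, p'.2.2.1 + n * s)) (continuousAt_gI hp'.1)
        hc.continuousAt
    have h3 : ContinuousAt (fun p : Amb A => p.2.2.2 n) p := by fun_prop
    have h4 : ∀ᶠ p' in 𝓝 p, p'.2.2.2 n ≠ gI p'.1 (p'.2.2.1 + n * s) := by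
      have h5 : ∀ᶠ z in 𝓝 (p.2.2.2 n, gI p.1 (p.2.2.1 + n * s)), z.1 ≠ z.2 :=
        (isOpen_ne_fun continuous_fst continuous_snd).mem_nhds hp'.2
      exact (h3.prodMk h2).eventually h5
    filter_upwards [h1, h4] with p' h6 h7
    simp only [mem_compl_iff, mem_ofPred_eq, Classical.not_imp]
    exact ⟨h6, h7⟩

/-- the covering space -/
def Xt (a : ℕ → A) (s : ℝ) : Type := {p : Amb A // Good a s p}

variable (a : ℕ → A) (s : ℝ)

instance : TopologicalSpace (Xt a s) := instTopologicalSpaceSubtype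

variable {a s}

/-- odometer coordinate -/
def Xt.κ (p : Xt a s) : Odo := p.1.1
/-- symbolic coordinate -/
def Xt.x (p : Xt a s) : ℤ → A := p.1.2.1
/-- real coordinate -/
def Xt.r (p : Xt a s) : ℝ := p.1.2.2.1
/-- fibre coordinate -/
def Xt.w (p : Xt a s) : ℤ → unitInterval := p.1.2.2.2

lemma Xt.sym (p : Xt a s) : Sym a p.κ p.x := p.2.1
lemma Xt.weq (p : Xt a s) (n : ℤ) (h : DD p.κ (p.r + n * s) ≠ 0) : p.w n = gI p.κ (p.r + n * s) :=
  p.2.2 n h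

/-- constructor -/
def Xt.mk (κ : Odo) (x : ℤ → A) (r : ℝ) (w : ℤ → unitInterval) (h1 : Sym a κ x)
    (h2 : ∀ n : ℤ, DD κ (r + n * s) ≠ 0 → w n = gI κ (r + n * s)) : Xt a s :=
  ⟨(κ, x, r, w), h1, h2⟩

lemma Xt.ext' {p p' : Xt a s} (h1 : p.κ = p'.κ) (h2 : p.x = p'.x) (h3 : p.r = p'.r)
    (h4 : p.w = p'.w) : p = p' :=
  Subtype.ext (Prod.ext h1 (Prod.ext h2 (Prod.ext h3 h4)))

lemma Xt.isClosedEmbedding [T2Space A] : IsClosedEmbedding (Subtype.val : Xt a s → Amb A) :=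
  (isClosed_Good a s).isClosedEmbedding_subtypeVal

lemma Xt.cκ : Continuous (Xt.κ : Xt a s → Odo) := continuous_fst.comp continuous_subtype_val
lemma Xt.cx : Continuous (Xt.x : Xt a s → ℤ → A) :=
  (continuous_fst.comp continuous_snd).comp continuous_subtype_val
lemma Xt.cr : Continuous (Xt.r : Xt a s → ℝ) :=
  ((continuous_fst.comp continuous_snd).comp continuous_snd).comp continuous_subtype_val
lemma Xt.cw : Continuous (Xt.w : Xt a s → ℤ → unitInterval) :=
  ((continuous_snd.comp continuous_snd).comp continuous_snd).comp continuous_subtype_val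

lemma Xt.continuous_iff {Y : Type*} [TopologicalSpace Y] {f : Y → Xt a s}
    (h1 : Continuous fun y => (f y).κ) (h2 : Continuous fun y => (f y).x)
    (h3 : Continuous fun y => (f y).r) (h4 : Continuous fun y => (f y).w) : Continuous f :=
  continuous_induced_rng.mpr (h1.prodMk (h2.prodMk (h3.prodMk h4)))

/-- deck transformation together with flow-step -/
def Xt.act (m j : ℤ) (p : Xt a s) : Xt a s :=
  Xt.mk (p.κ + (m : Odo)) (fun n => p.x (n + m)) (p.r - m + j * s) (fun n => p.w (n + j))
    (Sym_shift a p.sym m) (by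
      intro n h
      have e : p.r - m + j * s + n * s = (p.r + ((n + j : ℤ) : ℝ) * s) - m := by push_cast; ring
      rw [e] at h ⊢
      rw [DD_shift] at h
      rw [gI_shift]
      exact p.weq _ h)

lemma Xt.act_act (m j m' j' : ℤ) (p : Xt a s) : (p.act m j).act m' j' = p.act (m + m') (j + j') := by
  apply Xt.ext'
  · change p.κ + (m : Odo) + (m' : Odo) = p.κ + ((m + m' : ℤ) : Odo)
    push_cast; ring
  · funext n
    change p.x (n + m' + m) = p.x (n + (m + m'))
    congr 1; ring
  · change p.r - m + j * s - m' + j' * s = p.r - ((m + m' : ℤ) : ℝ) + ((j + j' : ℤ) : ℝ) * s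
    push_cast; ring
  · funext n
    change p.w (n + j' + j) = p.w (n + (j + j'))
    congr 1; ring

lemma Xt.act_zero (p : Xt a s) : p.act 0 0 = p := by
  apply Xt.ext'
  · change p.κ + ((0 : ℤ) : Odo) = p.κ
    simp
  · funext n
    change p.x (n + 0) = p.x n
    simp
  · change p.r - ((0 : ℤ) : ℝ) + ((0 : ℤ) : ℝ) * s = p.r
    simp
  · funext n
    change p.w (n + 0) = p.w n
    simp

lemma Xt.continuous_act (m j : ℤ) : Continuous (fun p : Xt a s => p.act m j) := by
  apply Xt.continuous_iff
  · change Continuous fun p : Xt a s => p.κ + (m : Odo)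
    have := (Xt.cκ : Continuous (Xt.κ : Xt a s → Odo))
    fun_prop
  · change Continuous fun p : Xt a s => (fun n => p.x (n + m))
    exact continuous_pi fun n => (continuous_apply (n + m)).comp Xt.cx
  · change Continuous fun p : Xt a s => p.r - m + j * s
    have := (Xt.cr : Continuous (Xt.r : Xt a s → ℝ))
    fun_prop
  · change Continuous fun p : Xt a s => (fun n => p.w (n + j))
    exact continuous_pi fun n => (continuous_apply (n + j)).comp Xt.cw

instance : AddAction ℤ (Xt a s) where
  vadd m p := p.act m 0
  zero_vadd p := p.act_zero
  add_vadd m m' p := by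
    change p.act (m + m') 0 = (p.act m' 0).act m 0
    rw [Xt.act_act, add_comm, add_zero]

lemma Xt.vadd_def (m : ℤ) (p : Xt a s) : m +ᵥ p = p.act m 0 := rfl

instance : ContinuousConstVAdd ℤ (Xt a s) := ⟨fun m => Xt.continuous_act m 0⟩

instance [T2Space A] : T2Space (Xt a s) := inferInstanceAs (T2Space (Subtype _))

instance (k : ℕ) : SecondCountableTopology (ZMod (pp k)) := by
  have : Countable (ZMod (pp k)) := Finite.to_countable
  infer_instance

instance : SecondCountableTopology Odo :=
  TopologicalSpace.Subtype.secondCountableTopology (OdoR : Set (∀ k, ZMod (pp k)))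

instance [SecondCountableTopology A] : SecondCountableTopology (Xt a s) :=
  TopologicalSpace.Subtype.secondCountableTopology {p : Amb A | Good a s p}

instance [T2Space A] [CompactSpace A] : LocallyCompactSpace (Xt a s) :=
  Xt.isClosedEmbedding.locallyCompactSpace

lemma Xt.r_act (m j : ℤ) (p : Xt a s) : (p.act m j).r = p.r - m + j * s := rfl
lemma Xt.κ_act (m j : ℤ) (p : Xt a s) : (p.act m j).κ = p.κ + (m : Odo) := rfl
lemma Xt.x_act (m j : ℤ) (p : Xt a s) (n : ℤ) : (p.act m j).x n = p.x (n + m) := rfl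
lemma Xt.w_act (m j : ℤ) (p : Xt a s) (n : ℤ) : (p.act m j).w n = p.w (n + j) := rfl

instance : ProperlyDiscontinuousVAdd ℤ (Xt a s) where
  finite_disjoint_inter_image := by
    intro K L hK hL
    obtain ⟨B, hB⟩ := (hK.image Xt.cr).isBounded.exists_norm_le
    obtain ⟨C, hC⟩ := (hL.image Xt.cr).isBounded.exists_norm_le
    refine (Set.finite_Icc (-⌈B + C⌉) (⌈B + C⌉)).subset ?_
    rintro m ⟨p', ⟨p, hp, rfl⟩, hp'⟩
    have h1 := hB _ ⟨p, hp, rfl⟩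
    have h2 := hC _ ⟨_, hp', rfl⟩
    simp only [Xt.vadd_def, Xt.r_act] at h2
    rw [Real.norm_eq_abs, abs_le] at h1 h2
    have h3 := Int.le_ceil (B + C)
    constructor
    · have : ((-⌈B + C⌉ : ℤ) : ℝ) ≤ m := by
        push_cast at h2 ⊢; linarith
      exact_mod_cast this
    · have : (m : ℝ) ≤ (⌈B + C⌉ : ℤ) := by
        push_cast at h2 ⊢; linarith
      exact_mod_cast this

instance : IsCancelVAdd ℤ (Xt a s) where
  right_cancel' m m' p h := by
    have h1 : (p.act m 0).r = (p.act m' 0).r := congrArg Xt.r h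
    rw [Xt.r_act, Xt.r_act] at h1
    have : (m : ℝ) = m' := by linarith
    exact_mod_cast this

variable (a s)

/-- the space -/
def XX : Type := Quotient (AddAction.orbitRel ℤ (Xt a s))

instance : TopologicalSpace (XX a s) := instTopologicalSpaceQuotient

variable {a s}

/-- the projection -/
def q (p : Xt a s) : XX a s := Quotient.mk _ p

lemma q_surj : Function.Surjective (q : Xt a s → XX a s) := Quot.mk_surjective

lemma q_open : IsOpenQuotientMap (q : Xt a s → XX a s) := AddAction.isOpenQuotientMap_quotientMk

lemma cq : Continuous (q : Xt a s → XX a s) := q_open.continuous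

lemma q_eq {p p' : Xt a s} : q p = q p' ↔ ∃ m : ℤ, p = p'.act m 0 := by
  have h : q p = q p' ↔ (AddAction.orbitRel ℤ (Xt a s)) p p' := Quotient.eq (r := AddAction.orbitRel ℤ (Xt a s))
  rw [h, AddAction.orbitRel_apply, AddAction.mem_orbit_iff]
  exact ⟨fun ⟨m, h⟩ => ⟨m, h.symm⟩, fun ⟨m, h⟩ => ⟨m, h.symm⟩⟩

lemma q_act (m : ℤ) (j : ℤ) (p : Xt a s) : q (p.act m j) = q (p.act 0 j) :=
  q_eq.mpr ⟨m, by rw [Xt.act_act]; simp⟩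

lemma q_act' (m : ℤ) (p : Xt a s) : q (p.act m 0) = q p := by
  rw [q_act, Xt.act_zero]

instance [T2Space A] [CompactSpace A] : T2Space (XX a s) :=
  t2Space_of_properlyDiscontinuousVAdd_of_t2Space

instance [SecondCountableTopology A] : SecondCountableTopology (XX a s) :=
  ContinuousConstVAdd.secondCountableTopology

/-- compact slab -/
lemma Xt.isCompact_slab [T2Space A] [CompactSpace A] (c d : ℝ) :
    IsCompact {p : Xt a s | p.r ∈ Icc c d} := by
  have h : IsCompact ((univ : Set Odo) ×ˢ (univ : Set (ℤ → A)) ×ˢ Icc c d ×ˢ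
      (univ : Set (ℤ → unitInterval))) :=
    isCompact_univ.prod (isCompact_univ.prod (isCompact_Icc.prod isCompact_univ))
  have h2 := (Xt.isClosedEmbedding (a := a) (s := s)).isCompact_preimage h
  refine h2.of_isClosed_subset (isClosed_Icc.preimage Xt.cr) ?_
  intro p hp
  exact ⟨mem_univ _, mem_univ _, hp, mem_univ _⟩

lemma exists_rep (y : XX a s) (c : ℝ) : ∃ p : Xt a s, q p = y ∧ p.r ∈ Ico c (c + 1) := by
  obtain ⟨p, rfl⟩ := q_surj y
  refine ⟨p.act ⌊p.r - c⌋ 0, q_act' _ _, ?_⟩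
  rw [Xt.r_act]
  have h1 := Int.floor_le (p.r - c)
  have h2 := Int.lt_floor_add_one (p.r - c)
  constructor <;> simp <;> linarith

instance [T2Space A] [CompactSpace A] : CompactSpace (XX a s) := by
  constructor
  have h := (Xt.isCompact_slab (a := a) (s := s) 0 1).image cq
  refine h.of_isClosed_subset isClosed_univ ?_
  intro y _
  obtain ⟨p, hp, h1⟩ := exists_rep y 0
  exact ⟨p, ⟨h1.1, by have := h1.2; linarith⟩, hp⟩

lemma q_cov [T2Space A] [CompactSpace A] : IsCoveringMap (q : Xt a s → XX a s) :=
  (isAddQuotientCoveringMap_quotientMk_of_properlyDiscontinuousVAdd (G := ℤ)).isCoveringMap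

/-- the dynamics -/
def TT (j : ℤ) : XX a s → XX a s :=
  Quotient.lift (fun p : Xt a s => q (p.act 0 j)) (by
    intro p p' h
    have h' : q p = q p' := Quotient.sound h
    obtain ⟨m, rfl⟩ := q_eq.mp h'
    rw [Xt.act_act]
    simp only [add_zero, zero_add]
    exact q_act m j p')

lemma TT_q (j : ℤ) (p : Xt a s) : TT j (q p) = q (p.act 0 j) := rfl

lemma continuous_TT (j : ℤ) : Continuous (TT j : XX a s → XX a s) :=
  Continuous.quotient_lift (cq.comp (Xt.continuous_act 0 j)) _

lemma TT_TT (i j : ℤ) (y : XX a s) : TT i (TT j y) = TT (j + i) y := by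
  obtain ⟨p, rfl⟩ := q_surj y
  rw [TT_q, TT_q, TT_q, Xt.act_act]; simp

lemma TT_zero (y : XX a s) : TT 0 y = y := by
  obtain ⟨p, rfl⟩ := q_surj y
  rw [TT_q, Xt.act_zero]

variable (a s)
/-- the homeomorphism -/
def TH : XX a s ≃ₜ XX a s where
  toFun := TT 1
  invFun := TT (-1)
  left_inv y := by rw [TT_TT]; exact TT_zero y
  right_inv y := by rw [TT_TT]; exact TT_zero y
  continuous_toFun := continuous_TT 1
  continuous_invFun := continuous_TT (-1)
variable {a s}

lemma TH_iter (n : ℕ) (y : XX a s) : (⇑(TH a s))^[n] y = TT n y := by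
  induction n generalizing y with
  | zero => exact (TT_zero y).symm
  | succ n ih =>
    rw [Function.iterate_succ_apply, ih]
    change TT n (TT 1 y) = _
    rw [TT_TT]; congr 1; push_cast; ring

lemma hzpow_nat (n : ℕ) (y : XX a s) :
    ((fun S : XX a s ≃ₜ XX a s => S.trans (TH a s))^[n] (Homeomorph.refl _)) y = TT n y := by
  induction n with
  | zero => exact (TT_zero y).symm
  | succ n ih =>
    rw [Function.iterate_succ_apply']
    change TT 1 (((fun S : XX a s ≃ₜ XX a s => S.trans (TH a s))^[n] (Homeomorph.refl _)) y) = _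
    rw [ih, TT_TT]; congr 1

lemma hzpow_TH (n : ℤ) (y : XX a s) : hzpow (TH a s) n y = TT n y := by
  cases n with
  | ofNat n => exact hzpow_nat n y
  | negSucc n =>
    unfold hzpow
    rw [Homeomorph.symm_apply_eq, hzpow_nat, TT_TT]
    rw [← TT_zero y]
    rw [TT_TT]
    congr 1
    simp [Int.negSucc_eq]

end space
end Slov

set_option linter.unusedSectionVars false

namespace Slov

section minimal
variable {A : Type} [TopologicalSpace A] {a : ℕ → A} {s : ℝ}

lemma odo_nhds {κ : Odo} {V : Set Odo} (h : V ∈ 𝓝 κ) : ∃ K, ∀ κ' : Odo, κ'.1 K = κ.1 K → κ' ∈ V := by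
  rw [nhds_subtype_eq_comap, mem_comap] at h
  obtain ⟨t, ht, hV⟩ := h
  rw [nhds_pi, Filter.mem_pi] at ht
  obtain ⟨I, hI, u, hu, hs⟩ := ht
  obtain ⟨K, hK⟩ := hI.bddAbove
  refine ⟨K, fun κ' h => hV (hs ?_)⟩
  intro i hi
  rw [eq_of_le h (hK hi)]
  exact mem_of_mem_nhds (hu i)

lemma pi_nhds {B : Type*} [TopologicalSpace B] {x : ℤ → B} {U : Set (ℤ → B)} (h : U ∈ 𝓝 x) :
    ∃ (M : ℕ) (V : ℤ → Set B), (∀ n, IsOpen (V n)) ∧ (∀ n, x n ∈ V n) ∧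
      ∀ x' : ℤ → B, (∀ n : ℤ, |n| ≤ M → x' n ∈ V n) → x' ∈ U := by
  rw [nhds_pi, Filter.mem_pi] at h
  obtain ⟨I, hI, u, hu, hs⟩ := h
  obtain ⟨M, hM⟩ := (hI.image (fun n : ℤ => n.natAbs)).bddAbove
  refine ⟨M, fun n => interior (u n), fun n => isOpen_interior,
    fun n => mem_interior_iff_mem_nhds.mpr (hu n), fun x' hx' => hs fun i hi => ?_⟩
  have h1 : i.natAbs ≤ M := hM ⟨i, hi, rfl⟩
  exact interior_subset (hx' i (by rw [Int.abs_eq_natAbs]; exact_mod_cast h1))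

lemma pi_nhds_metric {B : Type*} [PseudoMetricSpace B] {x : ℤ → B} {U : Set (ℤ → B)} (h : U ∈ 𝓝 x) :
    ∃ (M : ℕ) (δ : ℝ), 0 < δ ∧
      ∀ x' : ℤ → B, (∀ n : ℤ, |n| ≤ M → dist (x' n) (x n) < δ) → x' ∈ U := by
  obtain ⟨M, V, hV, hx, hU⟩ := pi_nhds h
  have h1 : ∀ n, ∃ δ > 0, Metric.ball (x n) δ ⊆ V n := fun n => Metric.isOpen_iff.mp (hV n) _ (hx n)
  choose δ hδ hb using h1
  obtain ⟨n0, _, hn0⟩ := (Finset.Icc (-(M : ℤ)) M).exists_min_image δ ⟨0, by simp⟩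
  refine ⟨M, δ n0, hδ n0, fun x' hx' => hU x' fun n hn => hb n ?_⟩
  have := hn0 n (by rw [Finset.mem_Icc]; exact abs_le.mp hn)
  exact (hx' n hn).trans_le this

lemma Xt.nhds_basis {p : Xt a s} {U : Set (Xt a s)} (h : U ∈ 𝓝 p) :
    ∃ (K M : ℕ) (δ : ℝ) (V : ℤ → Set A), 0 < δ ∧ (∀ n, IsOpen (V n)) ∧ (∀ n, p.x n ∈ V n) ∧
      ∀ p' : Xt a s, p'.κ.1 K = p.κ.1 K → (∀ n : ℤ, |n| ≤ M → p'.x n ∈ V n) →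
        |p'.r - p.r| < δ → (∀ n : ℤ, |n| ≤ M → dist (p'.w n) (p.w n) < δ) → p' ∈ U := by
  have h' : U ∈ comap (Subtype.val : Xt a s → Amb A) (𝓝 p.1) := by
    rw [← nhds_subtype_eq_comap]; exact h
  obtain ⟨t, ht, hU⟩ := mem_comap.mp h'
  obtain ⟨u1, h1, t2, h2, hs⟩ := mem_nhds_prod_iff.mp ht
  obtain ⟨u2, h2, t3, h3, hs2⟩ := mem_nhds_prod_iff.mp h2
  obtain ⟨u3, h3, t4, h4, hs3⟩ := mem_nhds_prod_iff.mp h3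
  obtain ⟨K, hK⟩ := odo_nhds h1
  obtain ⟨M1, V, hV, hx, hM1⟩ := pi_nhds h2
  obtain ⟨δ1, hδ1, hb⟩ := Metric.mem_nhds_iff.mp h3
  obtain ⟨M2, δ2, hδ2, hM2⟩ := pi_nhds_metric h4
  refine ⟨K, max M1 M2, min δ1 δ2, V, lt_min hδ1 hδ2, hV, hx, fun p' e1 e2 e3 e4 => hU (hs ?_)⟩
  refine ⟨hK _ e1, hs2 ⟨hM1 _ fun n hn => e2 n (hn.trans (by simp)), hs3 ⟨hb ?_, hM2 _ fun n hn => ?_⟩⟩⟩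
  · exact lt_of_lt_of_le (b := min δ1 δ2) e3 (min_le_left _ _)
  · exact (e4 n (hn.trans (by simp))).trans_le (min_le_right _ _)

/-- generic points -/
noncomputable def gen (a : ℕ → A) (s : ℝ) (r : ℝ) : Xt a s :=
  Xt.mk 0 (zz a) r (fun n => gI 0 (r + n * s))
    (by have := Sym_zz a 0; simpa using this) (fun n _ => rfl)

lemma DD_zero_iff {r : ℝ} : DD 0 r = 0 ↔ r = 0 := by
  rw [DD_eq_zero]
  constructor
  · rintro ⟨m, h, rfl⟩
    have : ((0 : ℤ) : Odo) = (m : Odo) := by rw [← h]; simp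
    rw [← odo_int_inj this]; simp
  · rintro rfl
    exact ⟨0, by simp, by simp⟩

lemma Xt.x_of_κ {p : Xt a s} (h : p.κ = 0) : p.x = zz a := by
  have h1 := p.sym
  rw [h] at h1
  have h2 : Sym a ((0 : ℤ) : Odo) p.x := by simpa using h1
  have := Sym_int_unique a h2
  simpa using this

lemma gen_unique {p : Xt a s} (h : p.κ = 0) (hr : ∀ n : ℤ, p.r + n * s ≠ 0) : p = gen a s p.r := by
  apply Xt.ext'
  · exact h
  · exact Xt.x_of_κ h
  · rfl
  · funext n
    have h1 : DD p.κ (p.r + n * s) ≠ 0 := by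
      rw [h, Ne, DD_zero_iff]; exact hr n
    rw [p.weq n h1, h]
    rfl

/-- forward density -/
lemma fwd_dense (hs : Irrational s) (P : ℕ) (hP : 0 < P) (c : ℝ) {δ : ℝ} (hδ : 0 < δ) :
    ∃ (j : ℕ) (m : ℤ), |c + j * s - P * m| < δ := by
  have hPR : (1 : ℝ) ≤ P := by exact_mod_cast hP
  have hd : Dense (AddSubgroup.closure {s, (P : ℝ)} : Set ℝ) := by
    rw [dense_addSubgroupClosure_pair_iff]
    exact hs.div_natCast hP.ne'
  have key : ∀ (c : ℝ) {δ : ℝ}, 0 < δ → ∃ (j m : ℤ), |j * s + m * P - c| < δ := by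
    intro c δ hδ
    obtain ⟨y, hy1, hy2⟩ := Metric.dense_iff.mp hd c δ hδ
    obtain ⟨j, m, h⟩ := AddSubgroup.mem_closure_pair.mp hy2
    refine ⟨j, m, ?_⟩
    rw [Metric.mem_ball, Real.dist_eq, ← h] at hy1
    simpa using hy1
  obtain ⟨j, m, h1⟩ := key (-c) (half_pos hδ)
  obtain ⟨N, hN⟩ : ∃ N : ℕ, N = j.natAbs + 1 := ⟨_, rfl⟩
  have hNR : (0 : ℝ) < N := by rw [hN]; positivity
  obtain ⟨ε, hε⟩ : ∃ ε : ℝ, ε = min (1 / 2) (δ / (2 * N)) := ⟨_, rfl⟩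
  have hε0 : 0 < ε := by rw [hε]; positivity
  have hε1 : ε ≤ 1 / 2 := by rw [hε]; exact min_le_left _ _
  have hε2 : N * ε ≤ δ / 2 := by
    have : ε ≤ δ / (2 * N) := by rw [hε]; exact min_le_right _ _
    calc N * ε ≤ N * (δ / (2 * N)) := by gcongr
      _ = δ / 2 := by field_simp
  obtain ⟨j', m', h2⟩ := key (ε / 2) (half_pos hε0)
  have h3 : j' ≠ 0 := by
    rintro rfl
    rw [abs_lt] at h2
    push_cast at h2
    have h4 : 0 < (m' : ℝ) * P := by linarith
    have h5 : 0 < m' := by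
      have : (0 : ℝ) < m' := by
        by_contra hc
        push Not at hc
        nlinarith
      exact_mod_cast this
    have h6 : (1 : ℝ) ≤ m' := by exact_mod_cast h5
    nlinarith
  have h4 : ∃ (J : ℕ) (m'' : ℤ), 1 ≤ J ∧ |J * s + m'' * P| < ε := by
    have h5 : |j' * s + m' * P| < ε := by
      rw [abs_lt] at h2 ⊢; constructor <;> linarith
    rcases le_total 0 j' with hj | hj
    · refine ⟨j'.toNat, m', by omega, ?_⟩
      have : ((j'.toNat : ℕ) : ℝ) = j' := by
        have : ((j'.toNat : ℕ) : ℤ) = j' := Int.toNat_of_nonneg hj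
        exact_mod_cast this
      rw [this]; exact h5
    · refine ⟨(-j').toNat, -m', by omega, ?_⟩
      have : (((-j').toNat : ℕ) : ℝ) = -j' := by
        have : (((-j').toNat : ℕ) : ℤ) = -j' := Int.toNat_of_nonneg (by omega)
        exact_mod_cast this
      rw [this, ← abs_neg]; push_cast
      convert h5 using 2; ring
  obtain ⟨J, m'', hJ, h5⟩ := h4
  have h6 : 0 ≤ j + N * J := by
    have : N * 1 ≤ N * J := Nat.mul_le_mul_left _ hJ
    have : (N : ℤ) ≤ N * J := by exact_mod_cast (by simpa using this)
    omega
  refine ⟨(j + N * J).toNat, -(m + N * m''), ?_⟩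
  have h7 : (((j + N * J).toNat : ℕ) : ℝ) = j + N * J := by
    have : (((j + N * J).toNat : ℕ) : ℤ) = j + N * J := Int.toNat_of_nonneg h6
    exact_mod_cast this
  rw [h7]
  push_cast
  have e : c + (j + N * J) * s - P * -(m + N * m'') = (j * s + m * P - -c) + N * (J * s + m'' * P) := by
    ring
  rw [e]
  refine (abs_add_le _ _).trans_lt ?_
  rw [abs_mul, abs_of_pos hNR]
  have := mul_le_mul_of_nonneg_left h5.le hNR.le
  linarith

variable [T2Space A] [CompactSpace A]

/-- fibers over generic points are singletons, so neighbourhoods are controlled by `κ, r` -/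
lemma gen_nhds {r0 : ℝ} (hr : ∀ n : ℤ, r0 + n * s ≠ 0) {U : Set (Xt a s)} (hU : IsOpen U)
    (h : gen a s r0 ∈ U) : ∃ (K : ℕ) (δ : ℝ), 0 < δ ∧ ∀ p : Xt a s, p.κ.1 K = 0 → |p.r - r0| < δ →
      p ∈ U := by
  have hC : IsCompact ({p : Xt a s | p.r ∈ Icc (r0 - 1) (r0 + 1)} \ U) :=
    (Xt.isCompact_slab _ _).diff hU
  have hc : Continuous fun p : Xt a s => (p.κ, p.r) := Xt.cκ.prodMk Xt.cr
  have hI := (hC.image hc).isClosed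
  have hn : ((0 : Odo), r0) ∉ (fun p : Xt a s => (p.κ, p.r)) ''
      ({p : Xt a s | p.r ∈ Icc (r0 - 1) (r0 + 1)} \ U) := by
    rintro ⟨p, ⟨_, hp⟩, he⟩
    have e1 : p.κ = 0 := congrArg Prod.fst he
    have e2 : p.r = r0 := congrArg Prod.snd he
    apply hp
    rw [gen_unique e1 (by rw [e2]; exact hr), e2]
    exact h
  obtain ⟨u, hu, v, hv, huv⟩ := mem_nhds_prod_iff.mp (hI.isOpen_compl.mem_nhds hn)
  obtain ⟨K, hK⟩ := odo_nhds hu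
  obtain ⟨δ, hδ, hb⟩ := Metric.mem_nhds_iff.mp hv
  refine ⟨K, min δ 1, lt_min hδ one_pos, fun p h1 h2 => ?_⟩
  by_contra hp
  have h3 : (p.κ, p.r) ∈ u ×ˢ v := ⟨hK _ h1, hb (h2.trans_le (min_le_left _ _))⟩
  refine huv h3 ⟨p, ⟨?_, hp⟩, rfl⟩
  have := (h2.trans_le (min_le_right _ _)).le
  rw [abs_le] at this
  constructor <;> linarith

lemma gen_mem_closure (hs : Irrational s) {r0 : ℝ} (hr : ∀ n : ℤ, r0 + n * s ≠ 0) (y : XX a s) :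
    q (gen a s r0) ∈ closure (range fun n : ℕ => TT (n : ℤ) y) := by
  rw [mem_closure_iff]
  intro O hO hg
  obtain ⟨K, δ, hδ, H⟩ := gen_nhds hr (hO.preimage cq) hg
  obtain ⟨p, rfl⟩ := q_surj y
  obtain ⟨j, m, hjm⟩ := fwd_dense hs (pp K) (pp_pos K) (p.r + res K p.κ - r0) hδ
  refine ⟨_, ?_, ⟨j, rfl⟩⟩
  have h1 := H (p.act (-(res K p.κ : ℤ) + pp K * m) j) ?_ ?_
  · change q _ ∈ O at h1
    rw [q_act] at h1
    exact h1
  · rw [Xt.κ_act, coord_add_int]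
    push_cast
    simp [res]
  · rw [Xt.r_act]
    push_cast
    convert hjm using 2
    ring

lemma gI_close (p : Xt a s) (M : ℕ) {η : ℝ} (hη : 0 < η) : ∃ (K : ℕ) (δ : ℝ), 0 < δ ∧
    ∀ (κ' : Odo) (r' : ℝ), κ'.1 K = p.κ.1 K → |r' - p.r| < δ → ∀ n : ℤ, |n| ≤ M →
      DD p.κ (p.r + n * s) ≠ 0 → dist (gI κ' (r' + n * s)) (p.w n) < η := by
  have h1 : ∀ n : ℤ, ∀ᶠ z in 𝓝 ((p.κ, p.r) : Odo × ℝ), DD p.κ (p.r + n * s) ≠ 0 →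
      dist (gI z.1 (z.2 + n * s)) (p.w n) < η := by
    intro n
    by_cases hn : DD p.κ (p.r + n * s) = 0
    · exact Eventually.of_forall fun z h => absurd hn h
    · rw [p.weq n hn]
      have hc : Continuous fun z : Odo × ℝ => (z.1, z.2 + n * s) := by fun_prop
      have h2 : ContinuousAt (fun z : Odo × ℝ => gI z.1 (z.2 + n * s)) (p.κ, p.r) :=
        ContinuousAt.comp' (g := fun z : Odo × ℝ => gI z.1 z.2)
          (f := fun z : Odo × ℝ => (z.1, z.2 + n * s)) (continuousAt_gI hn) hc.continuousAt
      exact (Metric.tendsto_nhds.mp h2 η hη).mono fun z h _ => h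
  have h2 : ∀ᶠ z in 𝓝 ((p.κ, p.r) : Odo × ℝ), ∀ n ∈ Finset.Icc (-(M : ℤ)) M,
      DD p.κ (p.r + n * s) ≠ 0 → dist (gI z.1 (z.2 + n * s)) (p.w n) < η :=
    (Finset.eventually_all _).mpr fun n _ => h1 n
  obtain ⟨u, hu, v, hv, huv⟩ := mem_nhds_prod_iff.mp h2
  obtain ⟨K, hK⟩ := odo_nhds hu
  obtain ⟨δ, hδ, hb⟩ := Metric.mem_nhds_iff.mp hv
  refine ⟨K, δ, hδ, fun κ' r' e1 e2 n hn hD => ?_⟩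
  have h3 : ((κ', r') : Odo × ℝ) ∈ u ×ˢ v := ⟨hK _ e1, hb e2⟩
  exact huv h3 n (by rw [Finset.mem_Icc]; exact abs_le.mp hn) hD

lemma osc_sol {v : ℝ} (hv0 : 0 ≤ v) (hv1 : v ≤ 1) {δ : ℝ} (hδ : 0 < δ) :
    ∃ e : ℝ, 0 < e ∧ e < δ ∧ e ≤ 1 / 4 ∧ gg 0 e = v := by
  have hC := CC_pos
  obtain ⟨N, hN⟩ := exists_nat_gt (1 / (CC * min δ (1 / 4)))
  have hm : 0 < min δ (1 / 4) := lt_min hδ (by norm_num)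
  have hN0 : (0 : ℝ) < N := lt_trans (by positivity) hN
  obtain ⟨θ, hθ⟩ : ∃ θ, θ = Real.arcsin (Real.sqrt v) + N * (2 * Real.pi) := ⟨_, rfl⟩
  have h1 : 0 ≤ Real.arcsin (Real.sqrt v) := Real.arcsin_nonneg.mpr (Real.sqrt_nonneg v)
  have h2 : (N : ℝ) ≤ θ := by
    have := Real.pi_gt_three
    rw [hθ]; nlinarith
  have h3 : 0 < θ := hN0.trans_le h2
  have h4 : 1 / (CC * θ) < min δ (1 / 4) := by
    have h5 := hN.trans_le h2
    rw [div_lt_iff₀ (by positivity)] at h5 ⊢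
    nlinarith
  have h5 := h4.trans_le (min_le_right _ _)
  refine ⟨1 / (CC * θ), by positivity, h4.trans_le (min_le_left _ _), h5.le, ?_⟩
  rw [gg_zero_pos (by positivity) h5.le]
  have e : 1 / (CC * (1 / (CC * θ))) = θ := by field_simp
  rw [e, hθ, Real.sin_add_nat_mul_two_pi, Real.sin_arcsin, Real.sq_sqrt hv0]
  · linarith [Real.sqrt_nonneg v]
  · have := Real.sqrt_le_sqrt hv1
    simpa using this

/-- the generic points -/
def GG (a : ℕ → A) (s : ℝ) : Set (XX a s) :=
  {y | ∃ r : ℝ, (∀ n : ℤ, r + n * s ≠ 0) ∧ y = q (gen a s r)}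

lemma dense_GG (ha : DenseRange a) (hs : 0 < s) : Dense (GG a s) := by
  intro y
  rw [mem_closure_iff]
  intro O hO hy
  obtain ⟨p, rfl⟩ := q_surj y
  obtain ⟨K, M, δ, V, hδ, hV, hx, H⟩ := Xt.nhds_basis ((hO.preimage cq).mem_nhds hy)
  obtain ⟨K1, δ1, hδ1, H1⟩ := gI_close p M hδ
  have main : ∀ (m : ℤ) (r' : ℝ), (m : Odo).1 K = p.κ.1 K → (m : Odo).1 K1 = p.κ.1 K1 →
      (∀ n : ℤ, |n| ≤ M → zz a (m + n) ∈ V n) → |r' - p.r| < δ → |r' - p.r| < δ1 →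
      (∀ n : ℤ, r' + m + n * s ≠ 0) →
      (∀ n : ℤ, DD p.κ (p.r + n * s) = 0 → dist (gI m (r' + n * s)) (p.w n) < δ) →
      (O ∩ GG a s).Nonempty := by
    intro m r' e1 e2 e3 e4 e5 e6 e7
    refine ⟨q (gen a s (r' + m)), ?_, r' + m, e6, rfl⟩
    rw [← q_act' m]
    have hw : ∀ n : ℤ, ((gen a s (r' + m)).act m 0).w n = gI m (r' + n * s) := by
      intro n
      change gI 0 (r' + m + ((n + 0 : ℤ) : ℝ) * s) = _
      rw [← gI_shift 0 _ m, zero_add, add_zero]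
      congr 1; ring
    have hr : ((gen a s (r' + m)).act m 0).r = r' := by
      change r' + m - m + ((0 : ℤ) : ℝ) * s = r'
      simp
    have hκ : ((gen a s (r' + m)).act m 0).κ = m := zero_add _
    refine H _ (by rw [hκ]; exact e1) ?_ (by rw [hr]; exact e4) ?_
    · intro n hn
      change zz a (n + m) ∈ V n
      rw [add_comm]; exact e3 n hn
    · intro n hn
      rw [hw]
      by_cases hD : DD p.κ (p.r + n * s) = 0
      · exact e7 n hD
      · exact H1 _ _ e2 e5 n hn hD
  by_cases hreg : ∃ n0 : ℤ, DD p.κ (p.r + n0 * s) = 0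
  · obtain ⟨n0, hn0⟩ := hreg
    obtain ⟨m, hm1, hm2⟩ := DD_eq_zero.mp hn0
    have hu : ∀ n : ℤ, DD p.κ (p.r + n * s) = 0 → n = n0 := by
      intro n hn
      obtain ⟨m', hm1', hm2'⟩ := DD_eq_zero.mp hn
      rw [hm1] at hm1'
      rw [← odo_int_inj hm1', ← hm2] at hm2'
      have h1 : (n : ℝ) * s = n0 * s := by linarith
      have h2 : (n : ℝ) = n0 := mul_right_cancel₀ hs.ne' h1
      exact_mod_cast h2
    have hmin : 0 < min (min δ δ1) s := lt_min (lt_min hδ hδ1) hs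
    obtain ⟨e, he0, he1, he2, he3⟩ := osc_sol (p.w n0).2.1 (p.w n0).2.2 hmin
    have hx' : p.x = fun n => zz a (m + n) := Sym_int_unique a (by rw [← hm1]; exact p.sym)
    refine main m (p.r + e) (by rw [hm1]) (by rw [hm1]) ?_ ?_ ?_ ?_ ?_
    · intro n _
      have := hx n
      rw [hx'] at this
      exact this
    · rw [add_sub_cancel_left, abs_of_pos he0]
      exact he1.trans_le ((min_le_left _ _).trans (min_le_left _ _))
    · rw [add_sub_cancel_left, abs_of_pos he0]
      exact he1.trans_le ((min_le_left _ _).trans (min_le_right _ _))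
    · intro n h
      have he4 := he1.trans_le (min_le_right _ _)
      have h2 : e = ((n0 - n : ℤ) : ℝ) * s := by push_cast; linarith
      rw [h2] at he0 he4
      have h3 : (0 : ℝ) < ((n0 - n : ℤ) : ℝ) := by
        by_contra hc; push Not at hc; nlinarith
      have h4 : ((n0 - n : ℤ) : ℝ) < 1 := by
        by_contra hc; push Not at hc; nlinarith
      have h3' : 0 < n0 - n := by exact_mod_cast h3
      have h4' : n0 - n < 1 := by exact_mod_cast h4
      omega
    · intro n hn
      rw [hu n hn]
      have h2 : gI m (p.r + e + n0 * s) = p.w n0 := by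
        apply Subtype.ext
        rw [← he3]
        have := gg_shift 0 e m
        rw [zero_add] at this
        rw [← this]
        change gg m (p.r + e + n0 * s) = _
        congr 1; linarith
      rw [h2, dist_self]
      exact hδ
  · push Not at hreg
    obtain ⟨m, hm1, hm2⟩ := zz_dense ha p.sym (max K K1) M V hV hx
    have hcnt : (range fun n : ℤ => -(n * s) - (m : ℝ)).Countable := countable_range _
    obtain ⟨r', hr1, hr2⟩ := Metric.dense_iff.mp (hcnt.dense_compl ℝ) p.r (min δ δ1) (lt_min hδ hδ1)
    rw [Metric.mem_ball, Real.dist_eq] at hr1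
    refine main m r' (eq_of_le hm1 (le_max_left _ _)) (eq_of_le hm1 (le_max_right _ _)) hm2
      (hr1.trans_le (min_le_left _ _)) (hr1.trans_le (min_le_right _ _)) ?_ ?_
    · intro n h
      exact hr2 ⟨n, by simp only; linarith⟩
    · intro n hn
      exact absurd hn (hreg n)

theorem minimal_TH (ha : DenseRange a) (hs : 0 < s) (hi : Irrational s) : IsMinimal (TH a s) := by
  intro y
  have e : (range fun n : ℕ => (TH a s)^[n] y) = range fun n : ℕ => TT (n : ℤ) y := by
    congr 1; funext n; exact TH_iter n y
  rw [e]
  have h1 : GG a s ⊆ closure (range fun n : ℕ => TT (n : ℤ) y) := by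
    rintro _ ⟨r, hr, rfl⟩
    exact gen_mem_closure hi hr y
  exact dense_closure.mp ((dense_GG ha hs).mono h1)

end minimal
end Slov

set_option linter.unusedSectionVars false

namespace Slov

lemma sine_block {R W : ℝ → ℝ} (hR : Continuous R) (hW : Continuous W) {c : ℝ} (h0 : R 0 ≤ c)
    (h1 : c < R 1) (h : ∀ t, 0 < R t - c → R t - c ≤ 1 / 4 → W t = gg 0 (R t - c)) : False := by
  have hS : IsCompact (Icc (0 : ℝ) 1 ∩ {t | R t ≤ c}) :=
    isCompact_Icc.inter_right (isClosed_le hR continuous_const)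
  obtain ⟨t0, ht0, hmax⟩ := hS.exists_isGreatest ⟨0, ⟨le_rfl, zero_le_one⟩, h0⟩
  have ht1 : t0 < 1 := by
    rcases lt_or_eq_of_le ht0.1.2 with h | h
    · exact h
    · have := ht0.2
      rw [h] at this
      exact absurd this (not_le.mpr h1)
  obtain ⟨η, hη, hc⟩ := Metric.continuous_iff.mp hW t0 (1 / 4) (by norm_num)
  obtain ⟨t1, ht1'⟩ : ∃ t1, t1 = min 1 (t0 + η / 2) := ⟨_, rfl⟩
  have a1 : t0 < t1 := by rw [ht1']; exact lt_min ht1 (by linarith)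
  have a2 : t1 ≤ 1 := by rw [ht1']; exact min_le_left _ _
  have a3 : t1 ≤ t0 + η / 2 := by rw [ht1']; exact min_le_right _ _
  have a4 : c < R t1 := by
    by_contra hcon
    push Not at hcon
    exact absurd (hmax ⟨⟨ht0.1.1.trans a1.le, a2⟩, hcon⟩) (not_le.mpr a1)
  have a5 : R t0 ≤ c := ht0.2
  have key : ∀ v : ℝ, 0 ≤ v → v ≤ 1 → |v - W t0| < 1 / 4 := by
    intro v hv0 hv1
    obtain ⟨e, he0, he1, he2, he3⟩ := osc_sol hv0 hv1 (sub_pos.mpr a4)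
    obtain ⟨t, ht, hte⟩ := intermediate_value_Icc a1.le hR.continuousOn
      (show c + e ∈ Icc (R t0) (R t1) from ⟨by linarith, by linarith⟩)
    have b1 : R t - c = e := by linarith
    have b2 := h t (by rw [b1]; exact he0) (by rw [b1]; exact he2)
    rw [b1, he3] at b2
    rw [← b2]
    apply hc
    rw [Real.dist_eq, abs_lt]
    have := ht.1
    have := ht.2
    constructor <;> linarith
  have k0 := key 0 le_rfl zero_le_one
  have k1 := key 1 zero_le_one le_rfl
  rw [abs_lt] at k0 k1
  linarith [k0.1, k1.2]

section rigid
variable {A : Type} [TopologicalSpace A] {a : ℕ → A} {s : ℝ}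

/-- singular path components -/
def QQ (a : ℕ → A) (s : ℝ) (n : ℤ) : Set (XX a s) :=
  {y | ∃ p : Xt a s, q p = y ∧ p.κ = 0 ∧ -((n + 1) * s) < p.r ∧ p.r ≤ -(n * s)}

lemma q_inj0 {p p' : Xt a s} (h : q p = q p') (h1 : p.κ = 0) (h2 : p'.κ = 0) : p = p' := by
  obtain ⟨m, rfl⟩ := q_eq.mp h
  rw [Xt.κ_act, h2, zero_add] at h1
  have : m = 0 := odo_int_inj (by rw [h1]; simp)
  rw [this, Xt.act_zero]

lemma int_of_Ioc (hs : 0 < s) {n m : ℤ} {r : ℝ} (h1 : -((n + 1) * s) < r) (h2 : r ≤ -(m * s)) : m ≤ n := by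
  have h3 : (m : ℝ) < n + 1 := by
    by_contra hc; push Not at hc; nlinarith
  have h4 : m < n + 1 := by exact_mod_cast h3
  omega

lemma QQ_disj (hs : 0 < s) {n m : ℤ} {y : XX a s} (h1 : y ∈ QQ a s n) (h2 : y ∈ QQ a s m) : n = m := by
  obtain ⟨p, hp, hκ, ha, hb⟩ := h1
  obtain ⟨p', hp', hκ', ha', hb'⟩ := h2
  have := q_inj0 (hp.trans hp'.symm) hκ hκ'
  subst this
  exact le_antisymm (int_of_Ioc hs ha' hb) (int_of_Ioc hs ha hb')

lemma mem_QQ_of_κ (hs : 0 < s) {p : Xt a s} (h : p.κ = 0) : ∃ n : ℤ, q p ∈ QQ a s n := by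
  refine ⟨⌊-p.r / s⌋, p, rfl, h, ?_, ?_⟩
  · have := Int.lt_floor_add_one (-p.r / s)
    rw [div_lt_iff₀ hs] at this
    linarith
  · have := Int.floor_le (-p.r / s)
    rw [le_div_iff₀ hs] at this
    linarith

/-- lifts of paths starting from `κ = 0` -/
lemma path_const_κ (Γ : C(unitInterval, Xt a s)) (t t' : unitInterval) : (Γ t).κ = (Γ t').κ := by
  apply Subtype.ext
  funext k
  have hc : Continuous fun t => (Γ t).κ.1 k :=
    ((continuous_apply k).comp continuous_subtype_val).comp (Xt.cκ.comp Γ.continuous)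
  exact PreconnectedSpace.constant inferInstance hc

lemma path_block (Γ : C(unitInterval, Xt a s)) (h : (Γ 0).κ = 0) (n : ℤ)
    (h0 : (Γ 0).r ≤ -(n * s)) : (Γ 1).r ≤ -(n * s) := by
  by_contra hc
  push Not at hc
  have hp : Continuous fun t : ℝ => Γ (projIcc 0 1 zero_le_one t) :=
    Γ.continuous.comp continuous_projIcc
  refine sine_block (R := fun t => (Γ (projIcc 0 1 zero_le_one t)).r)
    (W := fun t => ((Γ (projIcc 0 1 zero_le_one t)).w n : ℝ)) (c := -(n * s))
    (Xt.cr.comp hp) (continuous_subtype_val.comp ((continuous_apply n).comp (Xt.cw.comp hp))) ?_ ?_ ?_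
  · simpa using h0
  · simpa using hc
  · intro t ht0 _
    have e : (Γ (projIcc 0 1 zero_le_one t)).κ = 0 := by rw [path_const_κ Γ _ 0, h]
    have e2 := (Γ (projIcc 0 1 zero_le_one t)).weq n (by
      rw [e, Ne, DD_zero_iff]; intro h; linarith)
    rw [e2, e, sub_neg_eq_add]
    rfl

lemma path_block' (Γ : C(unitInterval, Xt a s)) (h : (Γ 0).κ = 0) (n : ℤ)
    (h0 : -(n * s) < (Γ 0).r) : -(n * s) < (Γ 1).r := by
  by_contra hc
  push Not at hc
  let Γ' : C(unitInterval, Xt a s) := ⟨fun t => Γ (unitInterval.symm t),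
    Γ.continuous.comp unitInterval.continuous_symm⟩
  have e0 : Γ' 0 = Γ 1 := by simp [Γ']
  have e1 : Γ' 1 = Γ 0 := by simp [Γ']
  have := path_block Γ' (by rw [e0, path_const_κ Γ 1 0, h]) n (by rw [e0]; exact hc)
  rw [e1] at this
  linarith

variable [T2Space A] [CompactSpace A]

lemma QQ_joined {n : ℤ} {y y' : XX a s} (h : y ∈ QQ a s n) (hj : Joined y y') : y' ∈ QQ a s n := by
  obtain ⟨p, hp, hκ, h1, h2⟩ := h
  obtain ⟨γ⟩ := hj
  obtain ⟨Γ, hΓ, hΓ0⟩ := q_cov.exists_path_lifts γ.toContinuousMap p (by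
    change γ 0 = q p
    rw [γ.source, hp])
  have e : q (Γ 1) = y' := by
    have := congrFun hΓ 1
    exact this.trans γ.target
  refine ⟨Γ 1, e, by rw [path_const_κ Γ 1 0, hΓ0, hκ], ?_, ?_⟩
  · have := path_block' Γ (by rw [hΓ0, hκ]) (n + 1) (by rw [hΓ0]; push_cast; exact h1)
    push_cast at this
    exact this
  · exact path_block Γ (by rw [hΓ0, hκ]) n (by rw [hΓ0]; exact h2)

lemma continuousOn_gI_Iic : ContinuousOn (fun e : ℝ => gI 0 e) (Iic 0) := by
  intro e he
  rcases lt_or_eq_of_le (show e ≤ 0 from he) with h | h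
  · refine ContinuousAt.continuousWithinAt ?_
    have hc : Continuous fun z : ℝ => ((0 : Odo), z) := by fun_prop
    exact ContinuousAt.comp' (g := fun z : Odo × ℝ => gI z.1 z.2)
        (f := fun z : ℝ => ((0 : Odo), z)) (continuousAt_gI (by rw [Ne, DD_zero_iff]; exact h.ne))
          hc.continuousAt
  · subst h
    have h2 : ∀ᶠ e in 𝓝[Iic (0 : ℝ)] 0, gI 0 e = gI 0 0 := by
      have h3 : Ioi (-(1 / 4) : ℝ) ∈ 𝓝 (0 : ℝ) := Ioi_mem_nhds (by norm_num)
      filter_upwards [self_mem_nhdsWithin, mem_nhdsWithin_of_mem_nhds h3] with e he1 he2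
      apply Subtype.ext
      have he2' : -(1 / 4) < e := he2
      exact (gg_zero_neg he1 he2'.le).trans (gg_zero_neg le_rfl (by norm_num)).symm
    exact ContinuousWithinAt.congr_of_eventuallyEq continuousWithinAt_const h2 rfl

lemma continuousOn_gI_Ioi : ContinuousOn (fun e : ℝ => gI 0 e) (Ioi 0) := by
  intro e he
  refine ContinuousAt.continuousWithinAt ?_
  have hc : Continuous fun z : ℝ => ((0 : Odo), z) := by fun_prop
  have he' : e ≠ 0 := ne_of_gt he
  exact ContinuousAt.comp' (g := fun z : Odo × ℝ => gI z.1 z.2)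
        (f := fun z : ℝ => ((0 : Odo), z)) (continuousAt_gI (by rw [Ne, DD_zero_iff]; exact he'))
          hc.continuousAt

lemma Xt.continuousOn_iff {Y : Type*} [TopologicalSpace Y] {f : Y → Xt a s} {S : Set Y}
    (h1 : ContinuousOn (fun y => (f y).κ) S) (h2 : ContinuousOn (fun y => (f y).x) S)
    (h3 : ContinuousOn (fun y => (f y).r) S) (h4 : ContinuousOn (fun y => (f y).w) S) :
    ContinuousOn f S := by
  rw [continuousOn_iff_continuous_domRestrict] at *
  exact Xt.continuous_iff h1 h2 h3 h4

lemma continuousOn_gen (hs : 0 < s) (n : ℤ) :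
    ContinuousOn (gen a s) (Ioc (-((n + 1) * s)) (-(n * s))) := by
  apply Xt.continuousOn_iff
  · exact continuousOn_const
  · exact continuousOn_const
  · exact continuousOn_id
  · rw [continuousOn_pi]
    intro m
    change ContinuousOn (fun r : ℝ => gI 0 (r + m * s)) _
    have hc : ContinuousOn (fun r : ℝ => r + m * s) (Ioc (-((n + 1) * s)) (-(n * s))) := by fun_prop
    rcases le_or_gt m n with h | h
    · refine continuousOn_gI_Iic.comp hc ?_
      intro r hr
      have h' : (m : ℝ) ≤ n := by exact_mod_cast h
      have := hr.2
      change r + m * s ≤ 0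
      nlinarith
    · refine continuousOn_gI_Ioi.comp hc ?_
      intro r hr
      have h' : (n : ℝ) + 1 ≤ m := by exact_mod_cast h
      have := hr.1
      change 0 < r + m * s
      nlinarith

/-- the fibre over a singular point -/
noncomputable def sing (a : ℕ → A) (hs : 0 < s) (n : ℤ) (v : unitInterval) : Xt a s :=
  Xt.mk 0 (zz a) (-(n * s)) (Function.update (fun m : ℤ => gI 0 (-(n * s) + m * s)) n v)
    (by have := Sym_zz a 0; simpa using this) (by
      intro m hm
      rw [Ne, DD_zero_iff] at hm
      have : m ≠ n := by rintro rfl; apply hm; ring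
      rw [Function.update_of_ne this])

lemma continuous_sing (hs : 0 < s) (n : ℤ) : Continuous (sing a hs n) := by
  apply Xt.continuous_iff
  · exact continuous_const
  · exact continuous_const
  · exact continuous_const
  · exact continuous_const.update n continuous_id

lemma sing_unique (hs : 0 < s) (n : ℤ) {p : Xt a s} (h : p.κ = 0) (hr : p.r = -(n * s)) :
    p = sing a hs n (p.w n) := by
  apply Xt.ext'
  · exact h
  · exact Xt.x_of_κ h
  · exact hr
  · funext m
    by_cases hm : m = n
    · subst hm
      change p.w m = Function.update (fun m' : ℤ => gI 0 (-(m * s) + m' * s)) m (p.w m) m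
      rw [Function.update_self]
    · change p.w m = Function.update (fun m' : ℤ => gI 0 (-(n * s) + m' * s)) n (p.w n) m
      rw [Function.update_of_ne hm, p.weq m, h, hr]
      rw [h, hr, Ne, DD_zero_iff]
      intro h2
      apply hm
      have h3 : (m : ℝ) * s = n * s := by linarith
      exact_mod_cast mul_right_cancel₀ hs.ne' h3

lemma joined_gen (hs : 0 < s) (n : ℤ) {p : Xt a s} (h : p.κ = 0) (h1 : -((n + 1) * s) < p.r)
    (h2 : p.r ≤ -(n * s)) : Joined (q p) (q (gen a s p.r)) := by
  rcases lt_or_eq_of_le h2 with h3 | h3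
  · rw [gen_unique h]
    · exact Joined.refl _
    · intro m hm
      have e : p.r = -(m * s) := by linarith
      have e1 := int_of_Ioc hs h1 e.le
      have e2 : (n : ℝ) < m := by
        by_contra hc; push Not at hc; nlinarith
      have e3 : n < m := by exact_mod_cast e2
      omega
  · have e1 := sing_unique hs n h h3
    have e2 := sing_unique hs n (p := gen a s p.r) rfl h3
    have hj : Joined (p.w n) ((gen a s p.r).w n) := by
      have hP : PathConnectedSpace (Icc (0:ℝ) 1) := isPathConnected_iff_pathConnectedSpace.mp
        ((convex_Icc 0 1).isPathConnected ⟨0, by simp⟩)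
      exact hP.joined _ _
    have := hj.map (cq.comp (continuous_sing (a := a) hs n))
    rw [Function.comp_apply, Function.comp_apply, ← e1, ← e2] at this
    exact this

lemma QQ_pc (hs : 0 < s) {n : ℤ} {y y' : XX a s} (h : y ∈ QQ a s n) (h' : y' ∈ QQ a s n) :
    Joined y y' := by
  obtain ⟨p, rfl, hκ, h1, h2⟩ := h
  obtain ⟨p', rfl, hκ', h1', h2'⟩ := h'
  refine (joined_gen hs n hκ h1 h2).trans (Joined.trans ?_ (joined_gen hs n hκ' h1' h2').symm)
  have hpc : IsPathConnected (Ioc (-((n + 1) * s)) (-(n * s))) :=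
    (convex_Ioc _ _).isPathConnected ⟨p.r, h1, h2⟩
  have h3 := hpc.image' (cq.comp_continuousOn (continuousOn_gen (a := a) hs n))
  exact (h3.joinedIn _ ⟨p.r, ⟨h1, h2⟩, rfl⟩ _ ⟨p'.r, ⟨h1', h2'⟩, rfl⟩).joined

lemma pathComponent_QQ (hs : 0 < s) {n : ℤ} {y : XX a s} (h : y ∈ QQ a s n) :
    pathComponent y = QQ a s n := by
  ext y'
  exact ⟨fun hj => QQ_joined h hj, fun h' => QQ_pc hs h h'⟩

lemma joined_TT {y : XX a s} (h : ∀ n : ℤ, y ∉ QQ a s n) (hs : 0 < s) : Joined y (TT 1 y) := by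
  obtain ⟨p, rfl⟩ := q_surj y
  have hκ : ∀ m : ℤ, p.κ ≠ (m : Odo) := by
    intro m hm
    obtain ⟨n, hn⟩ := mem_QQ_of_κ hs (p := p.act (-m) 0) (by
      rw [Xt.κ_act, hm]; push_cast; ring)
    rw [q_act'] at hn
    exact h n hn
  have hD : ∀ r, DD p.κ r ≠ 0 := by
    intro r hr
    obtain ⟨m, hm, _⟩ := DD_eq_zero.mp hr
    exact hκ m hm
  let f : ℝ → Xt a s := fun t => Xt.mk p.κ p.x (p.r + t * s) (fun n => gI p.κ (p.r + t * s + n * s))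
    p.sym (fun n _ => rfl)
  have hg : Continuous fun r : ℝ => gI p.κ r := by
    rw [continuous_iff_continuousAt]
    intro r
    have hc : Continuous fun z : ℝ => (p.κ, z) := by fun_prop
    exact ContinuousAt.comp' (g := fun z : Odo × ℝ => gI z.1 z.2)
        (f := fun z : ℝ => (p.κ, z)) (continuousAt_gI (hD r)) hc.continuousAt
  have hf : Continuous f := by
    apply Xt.continuous_iff
    · exact continuous_const
    · exact continuous_const
    · change Continuous fun t : ℝ => p.r + t * s
      fun_prop
    · refine continuous_pi fun n => ?_
      change Continuous fun t : ℝ => gI p.κ (p.r + t * s + n * s)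
      exact hg.comp (by fun_prop)
  have e0 : f 0 = p := by
    apply Xt.ext'
    · rfl
    · rfl
    · change p.r + 0 * s = p.r
      ring
    · funext n
      change gI p.κ (p.r + 0 * s + n * s) = _
      rw [p.weq n (hD _), zero_mul, add_zero]
  have e1 : f 1 = p.act 0 1 := by
    apply Xt.ext'
    · change p.κ = p.κ + ((0 : ℤ) : Odo)
      simp
    · funext n
      change p.x n = p.x (n + 0)
      simp
    · change p.r + 1 * s = p.r - ((0 : ℤ) : ℝ) + ((1 : ℤ) : ℝ) * s
      simp
    · funext n
      change gI p.κ (p.r + 1 * s + n * s) = p.w (n + 1)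
      rw [p.weq _ (hD _)]
      congr 1; push_cast; ring
  have hj : Joined (0 : ℝ) 1 := PathConnectedSpace.joined _ _
  have := hj.map (cq.comp hf)
  rw [Function.comp_apply, Function.comp_apply, e0, e1] at this
  exact this

lemma TT_QQ {n : ℤ} (j : ℤ) {y : XX a s} (h : y ∈ QQ a s n) : TT j y ∈ QQ a s (n - j) := by
  obtain ⟨p, rfl, hκ, h1, h2⟩ := h
  refine ⟨p.act 0 j, (TT_q j p).symm, by rw [Xt.κ_act, hκ]; simp, ?_, ?_⟩
  · rw [Xt.r_act]; push_cast; linarith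
  · rw [Xt.r_act]; push_cast; linarith

lemma dense_pc {y : XX a s} (h : ∀ n : ℤ, y ∉ QQ a s n) (ha : DenseRange a) (hs : 0 < s)
    (hi : Irrational s) : Dense (pathComponent y) := by
  refine Dense.mono ?_ (minimal_TH (a := a) ha hs hi y)
  rintro _ ⟨n, rfl⟩
  simp only [TH_iter]
  induction n with
  | zero => simp only [Nat.cast_zero, TT_zero]; exact Joined.refl y
  | succ n ih =>
    refine Joined.trans ih ?_
    have := joined_TT (y := TT (n : ℤ) y) ?_ hs
    · rw [TT_TT] at this
      exact this
    · intro m hm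
      have := TT_QQ (-(n : ℤ)) hm
      rw [TT_TT, add_neg_cancel, TT_zero] at this
      exact h _ this

lemma closure_QQ {n : ℤ} {y : XX a s} (h : y ∈ closure (QQ a s n)) :
    ∃ p : Xt a s, q p = y ∧ p.κ = 0 ∧ -((n + 1) * s) ≤ p.r ∧ p.r ≤ -(n * s) := by
  have hC : IsCompact ({p : Xt a s | p.r ∈ Icc (-((n + 1) * s)) (-(n * s))} ∩ {p | p.κ = 0}) :=
    (Xt.isCompact_slab _ _).inter_right (isClosed_eq Xt.cκ continuous_const)
  have h2 : QQ a s n ⊆ q '' ({p : Xt a s | p.r ∈ Icc (-((n + 1) * s)) (-(n * s))} ∩ {p | p.κ = 0}) := by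
    rintro _ ⟨p, rfl, hκ, h1, h2⟩
    exact ⟨p, ⟨⟨h1.le, h2⟩, hκ⟩, rfl⟩
  obtain ⟨p, ⟨h3, h4⟩, h5⟩ := closure_minimal h2 (hC.image cq).isClosed h
  exact ⟨p, h5, h4, h3.1, h3.2⟩

lemma closure_QQ_inter (hs : 0 < s) {n m : ℤ} (hnm : n ≠ m) {y : XX a s} (h : y ∈ closure (QQ a s n))
    (h' : y ∈ QQ a s m) : m = n + 1 ∧ ∃ p : Xt a s, q p = y ∧ p.κ = 0 ∧ p.r = -((n + 1) * s) := by
  obtain ⟨p, hp, hκ, h1, h2⟩ := closure_QQ h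
  obtain ⟨p', hp', hκ', h1', h2'⟩ := h'
  have := q_inj0 (hp.trans hp'.symm) hκ hκ'
  subst this
  have h3 : ¬ (-((n + 1) * s) < p.r) := by
    intro h3
    exact hnm (le_antisymm (int_of_Ioc hs h1' h2) (int_of_Ioc hs h3 h2'))
  have h4 : p.r = -((n + 1) * s) := le_antisymm (not_lt.mp h3) h1
  refine ⟨?_, p, hp, hκ, h4⟩
  apply le_antisymm
  · refine int_of_Ioc hs (r := p.r) ?_ h2'
    rw [h4]; push_cast; linarith
  · refine int_of_Ioc hs h1' ?_
    rw [h4]; push_cast; linarith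

lemma closure_QQ_nonempty (hs : 0 < s) (n : ℤ) : ∃ y : XX a s, y ∈ closure (QQ a s n) ∧ y ∈ QQ a s (n + 1) := by
  let S : Set (Xt a s) := {p | p.κ = 0 ∧ -((n + 1) * s) < p.r ∧ p.r ≤ -(n * s)}
  have hsub : S ⊆ {p : Xt a s | p.r ∈ Icc (-((n + 1) * s)) (-(n * s))} ∩ {p | p.κ = 0} :=
    fun p hp => ⟨⟨hp.2.1.le, hp.2.2⟩, hp.1⟩
  have hC : IsCompact ({p : Xt a s | p.r ∈ Icc (-((n + 1) * s)) (-(n * s))} ∩ {p | p.κ = 0}) :=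
    (Xt.isCompact_slab _ _).inter_right (isClosed_eq Xt.cκ continuous_const)
  have hcl : closure S ⊆ _ := closure_minimal hsub hC.isClosed
  have hSc : IsCompact (closure S) := hC.of_isClosed_subset isClosed_closure hcl
  have him := (hSc.image Xt.cr).isClosed
  have h1 : Ioc (-((n + 1) * s)) (-(n * s)) ⊆ Xt.r '' closure S := by
    intro r hr
    exact ⟨gen a s r, subset_closure ⟨rfl, hr.1, hr.2⟩, rfl⟩
  have hlt : -((n + 1) * s) < -(n * s) := by linarith
  have h2 : -((n + 1) * s) ∈ Xt.r '' closure S := by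
    refine closure_minimal h1 him ?_
    rw [closure_Ioc hlt.ne]
    exact ⟨le_rfl, hlt.le⟩
  obtain ⟨p, hp, hr⟩ := h2
  refine ⟨q p, ?_, p, rfl, (hcl hp).2, ?_, ?_⟩
  · have h3 : q '' S ⊆ QQ a s n := by
      rintro _ ⟨p, hp, rfl⟩
      exact ⟨p, rfl, hp⟩
    exact closure_mono h3 (image_closure_subset_closure_image cq ⟨p, hp, rfl⟩)
  · rw [hr]; push_cast; linarith
  · rw [hr]; push_cast; linarith

lemma QQ_nonempty (hs : 0 < s) (n : ℤ) : (QQ a s n).Nonempty :=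
  ⟨q (gen a s (-(n * s))), gen a s (-(n * s)), rfl, rfl,
    by change -((n + 1) * s) < -(n * s); linarith, le_rfl⟩

lemma not_dense_QQ (hs : 0 < s) (n : ℤ) : ¬ Dense (QQ a s n) := by
  intro h
  obtain ⟨y, hy⟩ := QQ_nonempty (a := a) hs (n - 1)
  obtain ⟨h1, -⟩ := closure_QQ_inter hs (show n ≠ n - 1 by omega) (h y) hy
  omega

/-- same base coordinates -/
def EE (a : ℕ → A) (s : ℝ) : Set (XX a s × XX a s) :=
  {z | ∃ p p' : Xt a s, q p = z.1 ∧ q p' = z.2 ∧ p.κ = p'.κ ∧ p.r = p'.r}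

lemma isClosed_EE : IsClosed (EE a s) := by
  have hC : IsCompact (({p : Xt a s | p.r ∈ Icc 0 1} ×ˢ {p : Xt a s | p.r ∈ Icc 0 1}) ∩
      {z | z.1.κ = z.2.κ ∧ z.1.r = z.2.r}) := by
    refine ((Xt.isCompact_slab _ _).prod (Xt.isCompact_slab _ _)).inter_right (IsClosed.inter ?_ ?_)
    · exact isClosed_eq (Xt.cκ.comp continuous_fst) (Xt.cκ.comp continuous_snd)
    · exact isClosed_eq (Xt.cr.comp continuous_fst) (Xt.cr.comp continuous_snd)
  have hc : Continuous fun z : Xt a s × Xt a s => (q z.1, q z.2) :=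
    (cq.comp continuous_fst).prodMk (cq.comp continuous_snd)
  have := (hC.image hc).isClosed
  convert this using 1
  ext ⟨y, y'⟩
  constructor
  · rintro ⟨p, p', rfl, rfl, h1, h2⟩
    refine ⟨(p.act ⌊p.r⌋ 0, p'.act ⌊p.r⌋ 0), ⟨⟨?_, ?_⟩, ?_, ?_⟩, ?_⟩
    · change (p.act ⌊p.r⌋ 0).r ∈ Icc (0:ℝ) 1
      rw [Xt.r_act]
      have h1 := Int.floor_le p.r
      have h2 := Int.lt_floor_add_one p.r
      constructor <;> push_cast <;> linarith
    · change (p'.act ⌊p.r⌋ 0).r ∈ Icc (0:ℝ) 1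
      rw [Xt.r_act, ← h2]
      have h1 := Int.floor_le p.r
      have h2 := Int.lt_floor_add_one p.r
      constructor <;> push_cast <;> linarith
    · change (p.act ⌊p.r⌋ 0).κ = (p'.act ⌊p.r⌋ 0).κ
      rw [Xt.κ_act, Xt.κ_act, h1]
    · change (p.act ⌊p.r⌋ 0).r = (p'.act ⌊p.r⌋ 0).r
      rw [Xt.r_act, Xt.r_act, h2]
    · change (q (p.act ⌊p.r⌋ 0), q (p'.act ⌊p.r⌋ 0)) = _
      rw [q_act', q_act']
  · rintro ⟨⟨p, p'⟩, ⟨_, h1, h2⟩, h3⟩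
    exact ⟨p, p', congrArg Prod.fst h3, congrArg Prod.snd h3, h1, h2⟩

lemma EE_GG {y y' : XX a s} (h : (y', y) ∈ EE a s) (hy : y ∈ GG a s) : y' = y := by
  obtain ⟨p', p, h1, h2, h3, h4⟩ := h
  obtain ⟨r, hr, rfl⟩ := hy
  obtain ⟨m, hm⟩ := q_eq.mp h2
  have e1 : (p'.act (-m) 0).κ = 0 := by
    rw [Xt.κ_act, h3, hm, Xt.κ_act]
    change (0 : Odo) + (m : Odo) + ((-m : ℤ) : Odo) = 0
    push_cast; ring
  have e2 : (p'.act (-m) 0).r = r := by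
    rw [Xt.r_act, h4, hm, Xt.r_act]
    change r - m + ((0 : ℤ) : ℝ) * s - ((-m : ℤ) : ℝ) + ((0 : ℤ) : ℝ) * s = r
    push_cast; ring
  have e3 := gen_unique e1 (by rw [e2]; exact hr)
  rw [e2] at e3
  rw [← e3, q_act']
  exact h1.symm

lemma pc_image (h : XX a s ≃ₜ XX a s) (y : XX a s) : h '' pathComponent y = pathComponent (h y) := by
  ext z
  constructor
  · rintro ⟨x, hx, rfl⟩
    exact Joined.map hx h.continuous
  · intro hz
    refine ⟨h.symm z, ?_, by simp⟩
    have := Joined.map hz h.symm.continuous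
    rw [h.symm_apply_apply] at this
    exact this

theorem rigid_TH (ha : DenseRange a) (hs : 0 < s) (hi : Irrational s) (h : XX a s ≃ₜ XX a s) :
    ∃ n : ℤ, h = hzpow (TH a s) n := by
  have hf : ∀ n : ℤ, ∃ m : ℤ, h '' QQ a s n = QQ a s m := by
    intro n
    obtain ⟨y, hy⟩ := QQ_nonempty (a := a) hs n
    have h1 : ∃ m : ℤ, h y ∈ QQ a s m := by
      by_contra hc
      push Not at hc
      have hd := dense_pc hc ha hs hi
      rw [← pc_image, pathComponent_QQ hs hy] at hd
      apply not_dense_QQ (a := a) hs n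
      have := hd.preimage h.isOpenMap
      rwa [preimage_image_eq _ h.injective] at this
    obtain ⟨m, hm⟩ := h1
    refine ⟨m, ?_⟩
    rw [← pathComponent_QQ hs hy, pc_image, pathComponent_QQ hs hm]
  choose f hf using hf
  have hstep : ∀ n, f (n + 1) = f n + 1 := by
    intro n
    obtain ⟨y, hy1, hy2⟩ := closure_QQ_nonempty (a := a) hs n
    have h1 : h y ∈ closure (QQ a s (f n)) := by
      rw [← hf n]
      exact image_closure_subset_closure_image h.continuous ⟨y, hy1, rfl⟩
    have h2 : h y ∈ QQ a s (f (n + 1)) := by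
      rw [← hf]; exact ⟨y, hy2, rfl⟩
    have h3 : f n ≠ f (n + 1) := by
      intro he
      rw [← he, ← hf n] at h2
      obtain ⟨z, hz, hzy⟩ := h2
      rw [h.injective hzy] at hz
      have := QQ_disj hs hz hy2
      omega
    exact (closure_QQ_inter hs h3 h1 h2).1
  have hfk : ∀ n, f n = n + f 0 := by
    intro n
    induction n using Int.induction_on with
    | zero => simp
    | succ n ih => rw [hstep, ih]; ring
    | pred n ih =>
      have := hstep (-(n : ℤ) - 1)
      rw [sub_add_cancel, ih] at this
      omega
  obtain ⟨k, hk⟩ : ∃ k, k = f 0 := ⟨_, rfl⟩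
  have hg : ∀ n y, y ∈ QQ a s n → TT k (h y) ∈ QQ a s n := by
    intro n y hy
    have h1 : h y ∈ QQ a s (f n) := by rw [← hf]; exact ⟨y, hy, rfl⟩
    have := TT_QQ k h1
    rwa [hfk n, ← hk, add_sub_cancel_right] at this
  have hgc : Continuous fun y => TT k (h y) := (continuous_TT k).comp h.continuous
  obtain ⟨y0, hy1, hy2⟩ := closure_QQ_nonempty (a := a) hs (-1)
  have hE : ∀ j : ℤ, (TT k (h (TT j y0)), TT j y0) ∈ EE a s := by
    intro j
    have b1 : TT j y0 ∈ closure (QQ a s (-1 - j)) := by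
      have : TT j '' QQ a s (-1) ⊆ QQ a s (-1 - j) := by
        rintro _ ⟨y, hy, rfl⟩; exact TT_QQ j hy
      exact closure_mono this (image_closure_subset_closure_image (continuous_TT j) ⟨y0, hy1, rfl⟩)
    have b2 : TT j y0 ∈ QQ a s (-1 + 1 - j) := TT_QQ j hy2
    have c1 : TT k (h (TT j y0)) ∈ closure (QQ a s (-1 - j)) := by
      have : (fun y => TT k (h y)) '' QQ a s (-1 - j) ⊆ QQ a s (-1 - j) := by
        rintro _ ⟨y, hy, rfl⟩; exact hg _ _ hy
      exact closure_mono this (image_closure_subset_closure_image hgc ⟨_, b1, rfl⟩)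
    have c2 := hg _ _ b2
    obtain ⟨-, p, hp1, hp2, hp3⟩ := closure_QQ_inter hs (by omega) b1 b2
    obtain ⟨-, p', hp1', hp2', hp3'⟩ := closure_QQ_inter hs (by omega) c1 c2
    exact ⟨p', p, hp1', hp1, by rw [hp2, hp2'], by rw [hp3, hp3']⟩
  have hall : ∀ y, (TT k (h y), y) ∈ EE a s := by
    have hcl : IsClosed {y | (TT k (h y), y) ∈ EE a s} := isClosed_EE.preimage (hgc.prodMk continuous_id)
    have hd := minimal_TH (a := a) ha hs hi y0
    have hsub : (range fun n : ℕ => (TH a s)^[n] y0) ⊆ {y | (TT k (h y), y) ∈ EE a s} := by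
      rintro _ ⟨n, rfl⟩
      simp only [TH_iter]
      exact hE n
    intro y
    exact closure_minimal hsub hcl (hd y)
  have hid : (fun y => TT k (h y)) = id := by
    refine Continuous.ext_on (dense_GG ha hs) hgc continuous_id ?_
    intro y hy
    exact EE_GG (hall y) hy
  refine ⟨-k, ?_⟩
  ext y
  rw [hzpow_TH]
  have := congrFun hid y
  simp only [id] at this
  rw [← this, TT_TT, add_neg_cancel, TT_zero, this]

end rigid
end Slov


set_option linter.unusedSectionVars false
set_option linter.unusedVariables false

namespace Slov

open Classical in
/-- holes at level `K` -/
noncomputable def HH (K : ℕ) : Finset ℕ :=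
  (Finset.range (pp K)).filter fun h => ∀ k < K, ¬ Bad k ((h : ℤ) : Odo)

lemma mem_HH {K h : ℕ} : h ∈ HH K ↔ h < pp K ∧ ∀ k < K, ¬ Bad k ((h : ℤ) : Odo) := by
  simp only [HH, Finset.mem_filter, Finset.mem_range]

lemma res_nat {k h : ℕ} (h0 : h < pp k) : res k ((h : ℤ) : Odo) = h := by
  have := res_int_nonneg (k := k) (n := (h : ℤ)) (by positivity) (by exact_mod_cast h0)
  exact_mod_cast this

lemma coord_eq_of_res {k : ℕ} {κ κ' : Odo} (h : res k κ = res k κ') : κ.1 k = κ'.1 k :=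
  ZMod.val_injective _ h

lemma card_HH_succ (K : ℕ) : (HH (K + 1)).card = (qq K - 1 - mm K) * (HH K).card := by
  have hq := qq_ge K
  have hp := pp_pos K
  rw [← Nat.card_Ico, ← Finset.card_product]
  have key : ∀ d h : ℕ, h < pp K → d < qq K →
      (d * pp K + h < pp (K + 1) ∧ dig K (((d * pp K + h : ℕ) : ℤ) : Odo) = d ∧
        (((d * pp K + h : ℕ) : ℤ) : Odo).1 K = ((h : ℤ) : Odo).1 K) := by
    intro d h hh hd
    have h1 : d * pp K + h < pp (K + 1) := by
      rw [pp_succ]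
      have : (d + 1) * pp K ≤ qq K * pp K := Nat.mul_le_mul_right _ hd
      nlinarith
    refine ⟨h1, ?_, ?_⟩
    · unfold dig
      rw [res_nat h1, add_comm, Nat.add_mul_div_right _ _ hp, Nat.div_eq_of_lt hh, zero_add]
    · rw [coord_int, coord_int]; simp
  refine Finset.card_nbij' (fun h => (h / pp K, h % pp K)) (fun z => z.1 * pp K + z.2) ?_ ?_ ?_ ?_
  · intro h hh
    rw [Finset.mem_coe, mem_HH] at hh
    have h1 : h / pp K < qq K := by
      rw [Nat.div_lt_iff_lt_mul hp]; have := hh.1; rw [pp_succ] at this; linarith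
    have h2 := Nat.mod_lt h hp
    obtain ⟨k1, k2, k3⟩ := key _ _ h2 h1
    rw [Nat.div_add_mod'] at k1 k2 k3
    have h3 := hh.2 K (Nat.lt_succ_self K)
    unfold Bad at h3
    rw [k2] at h3
    push Not at h3
    rw [Finset.mem_coe, Finset.mem_product, Finset.mem_Ico, mem_HH]
    refine ⟨⟨h3.1, ?_⟩, h2, fun k hk => ?_⟩
    · have := h3.2; change h / pp K < _; omega
    · change ¬ Bad k (((h % pp K : ℕ) : ℤ) : Odo)
      rw [← Bad_congr k3 hk]
      exact hh.2 k (by omega)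
  · rintro ⟨d, h⟩ hz
    rw [Finset.mem_coe, Finset.mem_product, Finset.mem_Ico, mem_HH] at hz
    obtain ⟨⟨z1, z2⟩, z3, z4⟩ := hz
    change mm K ≤ d at z1
    change d < qq K - 1 at z2
    change h < pp K at z3
    obtain ⟨k1, k2, k3⟩ := key d h z3 (by omega)
    rw [Finset.mem_coe, mem_HH]
    refine ⟨k1, fun k hk => ?_⟩
    rcases Nat.lt_succ_iff_lt_or_eq.mp hk with hk | rfl
    · rw [Bad_congr k3 hk]; exact z4 k hk
    · unfold Bad
      change ¬ (dig k (((d * pp k + h : ℕ) : ℤ) : Odo) < mm k ∨ dig k (((d * pp k + h : ℕ) : ℤ) : Odo) + 1 = qq k)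
      rw [k2]
      omega
  · intro h hh
    exact Nat.div_add_mod' _ _
  · rintro ⟨d, h⟩ hz
    rw [Finset.mem_coe, Finset.mem_product, Finset.mem_Ico, mem_HH] at hz
    have z3 : h < pp K := hz.2.1
    change ((d * pp K + h) / pp K, (d * pp K + h) % pp K) = (d, h)
    rw [add_comm, Nat.add_mul_div_right _ _ hp, Nat.div_eq_of_lt z3, zero_add,
      Nat.add_mul_mod_self_right, Nat.mod_eq_of_lt z3]

lemma card_HH (K : ℕ) : 2 * ((K : ℝ) + 1) * (HH K).card = (K + 2) * pp K := by
  induction K with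
  | zero =>
    have : HH 0 = {0} := by
      ext h; rw [mem_HH]; simp [pp]
    rw [this]; simp [pp]
  | succ K ih =>
    rw [card_HH_succ, pp_succ]
    have hq := qq_ge K
    have e : ((qq K - 1 - mm K : ℕ) : ℝ) = qq K - 1 - mm K := by
      rw [Nat.cast_sub (by omega), Nat.cast_sub (by omega)]; simp
    have e2 : (qq K : ℝ) = (mm K + 1) * (K + 2) ^ 2 := by unfold qq; push_cast; ring
    push_cast
    rw [e, e2]
    have h1 : ((K : ℝ) + 1) ≠ 0 := by positivity
    have h2 : ((HH K).card : ℝ) = (K + 2) * pp K / (2 * (K + 1)) := by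
      field_simp; linarith
    rw [h2]
    field_simp
    ring

lemma card_HH_ge (K : ℕ) : (pp K : ℝ) / 2 ≤ (HH K).card := by
  have h := card_HH K
  have h1 : (0 : ℝ) < K + 1 := by positivity
  have h2 : (0 : ℝ) < pp K := by exact_mod_cast pp_pos K
  by_contra hc
  push Not at hc
  nlinarith

lemma card_HH_tendsto : Tendsto (fun K : ℕ => ((HH K).card : ℝ) / pp K) atTop (𝓝 (1 / 2)) := by
  have e : (fun K : ℕ => ((HH K).card : ℝ) / pp K) = fun K : ℕ => 1 / 2 + (1 / 2) * (1 / ((K : ℝ) + 1)) := by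
    funext K
    have h := card_HH K
    have h1 : (0 : ℝ) < K + 1 := by positivity
    have h2 : (0 : ℝ) < pp K := by exact_mod_cast pp_pos K
    field_simp
    linarith
  rw [e]
  have := (tendsto_one_div_add_atTop_nhds_zero_nat (𝕜 := ℝ)).const_mul (1 / 2)
  simpa using this.const_add (1 / 2 : ℝ)

/-- partial sums for the special odometer point -/
def rho (K k : ℕ) : ℕ := ∑ l ∈ Finset.range k, if K ≤ l then mm l * pp l else 0

lemma rho_succ (K k : ℕ) : rho K (k + 1) = rho K k + if K ≤ k then mm k * pp k else 0 :=
  Finset.sum_range_succ _ _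

lemma rho_le (K k : ℕ) (h : k ≤ K) : rho K k = 0 := by
  unfold rho
  refine Finset.sum_eq_zero fun l hl => ?_
  rw [Finset.mem_range] at hl
  rw [if_neg (by omega)]

lemma rho_lt (K k h : ℕ) (hk : K ≤ k) (hh : h < pp K) : rho K k + h < pp k := by
  induction k, hk using Nat.le_induction with
  | base => rw [rho_le K K le_rfl]; omega
  | succ k hk ih =>
    rw [rho_succ, if_pos hk, pp_succ]
    have := qq_ge k
    have h2 : (mm k + 1) * pp k ≤ qq k * pp k := Nat.mul_le_mul_right _ (by omega)
    nlinarith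

/-- odometer point with permanent holes -/
def kst (K : ℕ) : Odo := ⟨fun k => (rho K k : ZMod (pp k)), by
  intro k
  change ZMod.castHom (pp_dvd_succ k) (ZMod (pp k)) ((rho K (k + 1) : ℕ) : ZMod (pp (k + 1))) = _
  rw [map_natCast, rho_succ]
  split_ifs <;> simp⟩

lemma res_kst {K k h : ℕ} (hk : K ≤ k) (hh : h < pp K) :
    res k (kst K + ((h : ℤ) : Odo)) = rho K k + h := by
  unfold res
  rw [coord_add_int]
  have : (kst K).1 k + (((h : ℤ) : ℤ) : ZMod (pp k)) = ((rho K k + h : ℕ) : ZMod (pp k)) := by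
    push_cast; rfl
  rw [this, ZMod.val_natCast, Nat.mod_eq_of_lt (rho_lt K k h hk hh)]

lemma kst_hole {K h : ℕ} (hh : h ∈ HH K) (k : ℕ) : ¬ FB k (kst K + ((h : ℤ) : Odo)) := by
  rw [mem_HH] at hh
  intro hF
  have hB := hF.1
  rcases lt_or_ge k K with hk | hk
  · have e : (kst K + ((h : ℤ) : Odo)).1 K = ((h : ℤ) : Odo).1 K := by
      apply coord_eq_of_res
      rw [res_kst le_rfl hh.1, res_nat hh.1, rho_le K K le_rfl, zero_add]
    rw [Bad_congr e hk] at hB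
    exact hh.2 k hk hB
  · have hd : dig k (kst K + ((h : ℤ) : Odo)) = mm k := by
      unfold dig
      rw [res_kst (by omega) hh.1, rho_succ, if_pos hk]
      have e : rho K k + mm k * pp k + h = (rho K k + h) + mm k * pp k := by ring
      rw [e, Nat.add_mul_div_right _ _ (pp_pos k), Nat.div_eq_of_lt (rho_lt K k h hk hh.1), zero_add]
    have := qq_ge k
    unfold Bad at hB
    omega

end Slov


set_option linter.unusedSectionVars false
set_option linter.unusedVariables false

namespace Slov

section low
variable {A : Type} [TopologicalSpace A] {a : ℕ → A} {s : ℝ}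
variable [T2Space A] [CompactSpace A] [SecondCountableTopology A]

noncomputable instance instMetricXX (a : ℕ → A) (s : ℝ) : MetricSpace (XX a s) :=
  TopologicalSpace.metrizableSpaceMetric (XX a s)

lemma bdd_sep {Z : Type*} [MetricSpace Z] [CompactSpace Z] {S : Z → Z} (hS : Continuous S) (n : ℕ)
    {ε : ℝ} (hε : 0 < ε) (K : Set Z) :
    BddAbove {m : ℕ | ∃ E : Finset Z, ↑E ⊆ K ∧ IsDynSep S n ε ↑E ∧ E.card = m} := by
  classical
  let U : Z → Set Z := fun x => ⋂ j ∈ Finset.range n, {y | dist (S^[j] x) (S^[j] y) < ε / 2}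
  have hU : ∀ x, U x ∈ 𝓝 x := by
    intro x
    refine (Filter.biInter_finset_mem _).mpr fun j _ => ?_
    have hc : Continuous fun y => dist (S^[j] x) (S^[j] y) := continuous_const.dist (hS.iterate j)
    exact (isOpen_lt hc continuous_const).mem_nhds (by simp; positivity)
  obtain ⟨t, ht⟩ := isCompact_univ.elim_nhds_subcover U (fun x _ => hU x)
  refine ⟨t.card, ?_⟩
  rintro m ⟨E, _, hE, rfl⟩
  have hx : ∀ y : Z, ∃ x ∈ t, y ∈ U x := by
    intro y
    have := ht.2 (mem_univ y)
    simpa using this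
  choose f hf hf2 using hx
  refine Finset.card_le_card_of_injOn f (fun y _ => hf y) ?_
  intro y hy y' hy' he
  by_contra hne
  obtain ⟨j, hj, hd⟩ := hE y hy y' hy' hne
  have h1 := hf2 y
  have h2 := hf2 y'
  rw [← he] at h2
  simp only [U, mem_iInter, Finset.mem_range, mem_ofPred_eq] at h1 h2
  have h1 := h1 j hj
  have h2 := h2 j hj
  rw [dist_comm] at h1
  have := dist_triangle (S^[j] y) (S^[j] (f y)) (S^[j] y')
  linarith

lemma sep_scale (S : Finset A) : ∃ ε > 0, ∀ p p' : Xt a s, p.r = p'.r → p.r ∈ Icc 0 s →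
    p.x 0 ∈ S → p'.x 0 ∈ S → p.x 0 ≠ p'.x 0 → ε < dist (q p) (q p') := by
  classical
  let D : Set (Xt a s × Xt a s) := ({p : Xt a s | p.r ∈ Icc 0 s} ×ˢ {p : Xt a s | p.r ∈ Icc 0 s}) ∩
    ({z | z.1.r = z.2.r} ∩ (fun z => (z.1.x 0, z.2.x 0)) ⁻¹' (S.offDiag : Set (A × A)))
  have hD : IsCompact D := by
    refine ((Xt.isCompact_slab 0 s).prod (Xt.isCompact_slab 0 s)).inter_right (IsClosed.inter ?_ ?_)
    · exact isClosed_eq (Xt.cr.comp continuous_fst) (Xt.cr.comp continuous_snd)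
    · refine (Finset.isClosed _).preimage ?_
      exact (((continuous_apply 0).comp Xt.cx).comp continuous_fst).prodMk
        (((continuous_apply 0).comp Xt.cx).comp continuous_snd)
  have hc : Continuous fun z : Xt a s × Xt a s => dist (q z.1) (q z.2) :=
    (cq.comp continuous_fst).dist (cq.comp continuous_snd)
  have hpos : ∀ z ∈ D, 0 < dist (q z.1) (q z.2) := by
    rintro ⟨p, p'⟩ ⟨_, h1, h2⟩
    rw [dist_pos]
    intro he
    obtain ⟨m, hm⟩ := q_eq.mp he
    have h3 := congrArg Xt.r hm
    rw [Xt.r_act] at h3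
    have h1' : p.r = p'.r := h1
    have h4 : (m : ℝ) = 0 := by
      change p.r = p'.r - m + ((0 : ℤ) : ℝ) * s at h3
      push_cast at h3; linarith
    have h5 : m = 0 := by exact_mod_cast h4
    subst h5
    rw [Xt.act_zero] at hm
    have hm' : p = p' := hm
    subst hm'
    simp at h2
  obtain ⟨ε, hε, h⟩ : ∃ ε > 0, ∀ z ∈ D, ε ≤ dist (q z.1) (q z.2) := by
    rcases D.eq_empty_or_nonempty with h0 | h0
    · exact ⟨1, one_pos, by rw [h0]; simp⟩
    · obtain ⟨z, hz, hz2⟩ := hD.exists_isMinOn h0 hc.continuousOn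
      exact ⟨_, hpos z hz, fun z' hz' => hz2 hz'⟩
  refine ⟨ε / 2, by positivity, fun p p' h1 h2 h3 h4 h5 => ?_⟩
  have := h (p, p') ⟨⟨h2, by change p'.r ∈ Icc 0 s; rw [← h1]; exact h2⟩, h1, by simp [h3, h4, h5]⟩
  change ε ≤ dist (q p) (q p') at this
  linarith

open Classical in
/-- filling of holes -/
noncomputable def fillx (a : ℕ → A) (κ : Odo) (φ : ℤ → A) (n : ℤ) : A :=
  if h : ∃ k, FB k (κ + (n : Odo)) then bv a h.choose (κ + (n : Odo)) else φ n

/-- point with filled holes -/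
noncomputable def fillp (a : ℕ → A) (s : ℝ) (κ : Odo) (φ : ℤ → A) : Xt a s :=
  Xt.mk κ (fillx a κ φ) 0 (fun n => gI κ (0 + n * s)) (by
    intro n k h
    have he : ∃ k, FB k (κ + (n : Odo)) := ⟨k, h⟩
    unfold fillx
    rw [dif_pos he, he.choose_spec.unique h]) (fun n _ => rfl)

lemma sep_count (hs : 0 < s) (S : Finset A) {ε : ℝ} (hε : 0 < ε)
    (h : ∀ p p' : Xt a s, p.r = p'.r → p.r ∈ Icc 0 s →
    p.x 0 ∈ S → p'.x 0 ∈ S → p.x 0 ≠ p'.x 0 → ε < dist (q p) (q p')) (K : ℕ) :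
    S.card ^ (HH K).card ≤ sepNum (⇑(TH a s)) (⌈(pp K : ℝ) / s⌉₊ + 1) ε univ := by
  classical
  let ext : (HH K → S) → ℤ → A := fun φ n =>
    if hn : n.toNat ∈ HH K then (φ ⟨n.toNat, hn⟩ : A) else a 0
  let P : (HH K → S) → XX a s := fun φ => q (fillp a s (kst K) (ext φ))
  have hx : ∀ (φ : HH K → S) (n : HH K), (fillp a s (kst K) (ext φ)).x ((n : ℕ) : ℤ) = φ n := by
    intro φ n
    change fillx a (kst K) (ext φ) ((n : ℕ) : ℤ) = φ n
    unfold fillx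
    rw [dif_neg (by rintro ⟨k, hk⟩; exact kst_hole n.2 k hk)]
    simp [ext]
  have key : ∀ φ φ' : HH K → S, φ ≠ φ' → ∃ j < ⌈(pp K : ℝ) / s⌉₊ + 1,
      ε < dist ((⇑(TH a s))^[j] (P φ)) ((⇑(TH a s))^[j] (P φ')) := by
    intro φ φ' hne
    obtain ⟨n, hn⟩ := Function.ne_iff.mp hne
    have hnp : (n : ℕ) < pp K := (mem_HH.mp n.2).1
    have hnp' : ((n : ℕ) : ℝ) ≤ pp K := by exact_mod_cast hnp.le
    refine ⟨⌈((n : ℕ) : ℝ) / s⌉₊, ?_, ?_⟩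
    · have : ⌈((n : ℕ) : ℝ) / s⌉₊ ≤ ⌈(pp K : ℝ) / s⌉₊ := Nat.ceil_mono (by gcongr)
      omega
    · rw [TH_iter, TH_iter, TT_q, TT_q, ← q_act (n : ℕ), ← q_act (n : ℕ) _ (fillp a s (kst K) (ext φ'))]
      apply h
      · rfl
      · rw [Xt.r_act]
        change 0 - (((n : ℕ) : ℤ) : ℝ) + ((⌈((n : ℕ) : ℝ) / s⌉₊ : ℤ) : ℝ) * s ∈ Icc 0 s
        push_cast
        have h1 := Nat.le_ceil (((n : ℕ) : ℝ) / s)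
        have h2 := Nat.ceil_lt_add_one (a := ((n : ℕ) : ℝ) / s) (by positivity)
        rw [div_le_iff₀ hs] at h1
        have h3 := mul_lt_mul_of_pos_right h2 hs
        rw [add_mul, div_mul_cancel₀ _ hs.ne'] at h3
        constructor <;> linarith
      · rw [Xt.x_act, zero_add, hx]; exact (φ n).2
      · rw [Xt.x_act, zero_add, hx]; exact (φ' n).2
      · rw [Xt.x_act, Xt.x_act, zero_add, hx, hx]
        intro he; exact hn (Subtype.ext he)
  have hinj : Function.Injective P := by
    intro φ φ' he
    by_contra hne
    obtain ⟨j, _, hj⟩ := key φ φ' hne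
    rw [he, dist_self] at hj
    linarith
  refine le_csSup (bdd_sep (TH a s).continuous _ hε univ) ⟨Finset.univ.image P, subset_univ _, ?_, ?_⟩
  · intro y hy y' hy' hne
    simp only [Finset.coe_image, Finset.coe_univ, image_univ, mem_range] at hy hy'
    obtain ⟨φ, rfl⟩ := hy
    obtain ⟨φ', rfl⟩ := hy'
    exact key φ φ' (by rintro rfl; exact hne rfl)
  · rw [Finset.card_image_of_injective _ hinj, Finset.card_univ]
    simp

theorem entropy_lower (hs : 0 < s) (S : Finset A) (hS : S.Nonempty) :
    ((s / 2 * Real.log S.card : ℝ) : EReal) ≤ dynEntropy (⇑(TH a s)) := by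
  obtain ⟨ε, hε, h⟩ := sep_scale (a := a) (s := s) S
  have h1 : entropyOnSet (⇑(TH a s)) univ ≤ dynEntropy (⇑(TH a s)) :=
    le_iSup₂ (f := fun (K : Set (XX a s)) (_ : IsCompact K) => entropyOnSet (⇑(TH a s)) K)
      univ isCompact_univ
  refine le_trans ?_ h1
  have h2 : (atTop.limsup fun n : ℕ => ((Real.log (sepNum (⇑(TH a s)) n ε univ) / n : ℝ) : EReal)) ≤
      entropyOnSet (⇑(TH a s)) univ :=
    le_iSup₂ (f := fun (ε : ℝ) (_ : 0 < ε) =>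
      atTop.limsup fun n : ℕ => ((Real.log (sepNum (⇑(TH a s)) n ε univ) / n : ℝ) : EReal)) ε hε
  refine le_trans ?_ h2
  have hcard : (1 : ℝ) ≤ S.card := by exact_mod_cast hS.card_pos
  have hlog : 0 ≤ Real.log S.card := Real.log_nonneg hcard
  let J : ℕ → ℕ := fun K => ⌈(pp K : ℝ) / s⌉₊ + 1
  have hpp : Tendsto (fun K => (pp K : ℝ)) atTop atTop :=
    tendsto_natCast_atTop_atTop.comp pp_strictMono.tendsto_atTop
  have hJ : Tendsto J atTop atTop := by
    have h0 := tendsto_nat_ceil_atTop.comp (hpp.atTop_div_const hs)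
    exact (tendsto_add_atTop_nat 1).comp h0
  have hb : ∀ K, (pp K : ℝ) / 2 * Real.log S.card / ((pp K : ℝ) / s + 2) ≤
      Real.log (sepNum (⇑(TH a s)) (J K) ε univ) / (J K : ℕ) := by
    intro K
    have e1 := sep_count hs S hε h K
    have e2 : ((S.card : ℝ)) ^ (HH K).card ≤ sepNum (⇑(TH a s)) (J K) ε univ := by exact_mod_cast e1
    have e3 := Real.log_le_log (by positivity) e2
    rw [Real.log_pow] at e3
    have e4 := card_HH_ge K
    have e5 : ((J K : ℕ) : ℝ) ≤ (pp K : ℝ) / s + 2 := by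
      have := Nat.ceil_lt_add_one (a := (pp K : ℝ) / s) (by positivity)
      simp only [J]; push_cast; linarith
    have e6 : (0 : ℝ) < (J K : ℕ) := by simp only [J]; positivity
    have e7 : (pp K : ℝ) / 2 * Real.log S.card ≤ Real.log (sepNum (⇑(TH a s)) (J K) ε univ) :=
      (mul_le_mul_of_nonneg_right e4 hlog).trans e3
    have e8 : 0 ≤ (pp K : ℝ) / 2 * Real.log S.card := by positivity
    exact div_le_div₀ (e8.trans e7) e7 e6 e5
  have hlim : Tendsto (fun K => (pp K : ℝ) / 2 * Real.log S.card / ((pp K : ℝ) / s + 2)) atTop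
      (𝓝 (s / 2 * Real.log S.card)) := by
    have e : (fun K => (pp K : ℝ) / 2 * Real.log S.card / ((pp K : ℝ) / s + 2)) =
        fun K => Real.log S.card / 2 / (1 / s + 2 * (pp K : ℝ)⁻¹) := by
      funext K
      have h2 : (0 : ℝ) < pp K := by exact_mod_cast pp_pos K
      field_simp
    rw [e]
    have h3 : Tendsto (fun K => 1 / s + 2 * (pp K : ℝ)⁻¹) atTop (𝓝 (1 / s + 2 * 0)) :=
      (hpp.inv_tendsto_atTop.const_mul 2).const_add _
    have h4 := (tendsto_const_nhds (x := Real.log S.card / 2)).div h3 (by simp; exact hs.ne')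
    have e2 : Real.log S.card / 2 / (1 / s + 2 * 0) = s / 2 * Real.log S.card := by
      field_simp
      ring
    rw [e2] at h4
    exact h4
  have hlim2 : Tendsto (fun K => (((pp K : ℝ) / 2 * Real.log S.card / ((pp K : ℝ) / s + 2) : ℝ) : EReal))
      atTop (𝓝 ((s / 2 * Real.log S.card : ℝ) : EReal)) :=
    (continuous_coe_real_ereal.tendsto _).comp hlim
  rw [← hlim2.limsup_eq]
  calc _ ≤ atTop.limsup ((fun n : ℕ => ((Real.log (sepNum (⇑(TH a s)) n ε univ) / n : ℝ) : EReal)) ∘ J) := by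
        refine limsup_le_limsup (Eventually.of_forall fun K => ?_)
        exact EReal.coe_le_coe_iff.mpr (hb K)
    _ ≤ _ := by
        rw [limsup_comp]
        exact limsup_le_limsup_of_le hJ

end low
end Slov


set_option linter.unusedSectionVars false
set_option linter.unusedVariables false

namespace Slov

section up
variable {A : Type} [TopologicalSpace A] {a : ℕ → A} {s : ℝ}

/-- closeness at scale `i` -/
def Clo (i : ℕ) (p p' : Xt a s) : Prop :=
  p.κ.1 i = p'.κ.1 i ∧ (∀ j : ℤ, |j| ≤ i → p.x j = p'.x j) ∧ |p.r - p'.r| ≤ 1 / ((i : ℝ) + 1) ∧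
    ∀ j : ℤ, |j| ≤ i → |(p.w j : ℝ) - p'.w j| ≤ 1 / ((i : ℝ) + 1)

lemma Clo.mono {i i' : ℕ} (h : i ≤ i') {p p' : Xt a s} (hc : Clo i' p p') : Clo i p p' := by
  obtain ⟨h1, h2, h3, h4⟩ := hc
  have hz : (i : ℤ) ≤ i' := by exact_mod_cast h
  have hr : 1 / ((i' : ℝ) + 1) ≤ 1 / ((i : ℝ) + 1) := by
    have : (i : ℝ) ≤ i' := by exact_mod_cast h
    gcongr
  exact ⟨eq_of_le h1 h, fun j hj => h2 j (hj.trans hz), h3.trans hr,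
    fun j hj => (h4 j (hj.trans hz)).trans hr⟩

lemma Clo.eq {p p' : Xt a s} (h : ∀ i, Clo i p p') : p = p' := by
  have hlim := tendsto_one_div_add_atTop_nhds_zero_nat (𝕜 := ℝ)
  apply Xt.ext'
  · apply Subtype.ext
    funext k
    exact (h k).1
  · funext j
    exact (h j.natAbs).2.1 j (by simp)
  · have h1 : |p.r - p'.r| ≤ 0 := ge_of_tendsto' hlim fun i => (h i).2.2.1
    have := abs_nonpos_iff.mp h1
    linarith
  · funext j
    apply Subtype.ext
    have h1 : |(p.w j : ℝ) - p'.w j| ≤ 0 := by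
      refine ge_of_tendsto hlim ?_
      filter_upwards [eventually_ge_atTop j.natAbs] with i hi
      refine (h i).2.2.2 j ?_
      rw [Int.abs_eq_natAbs]; exact_mod_cast hi
    have := abs_nonpos_iff.mp h1
    linarith

lemma isClosed_Clo [T2Space A] (i : ℕ) : IsClosed {z : Xt a s × Xt a s | Clo i z.1 z.2} := by
  have c1 : Continuous fun z : Xt a s × Xt a s => z.1 := continuous_fst
  have c2 : Continuous fun z : Xt a s × Xt a s => z.2 := continuous_snd
  have hk : Continuous fun κ : Odo => κ.1 i := (continuous_apply i).comp continuous_subtype_val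
  have e : {z : Xt a s × Xt a s | Clo i z.1 z.2} =
      {z | z.1.κ.1 i = z.2.κ.1 i} ∩ ((⋂ j : ℤ, ⋂ _ : |j| ≤ i, {z | z.1.x j = z.2.x j}) ∩
        ({z | |z.1.r - z.2.r| ≤ 1 / ((i : ℝ) + 1)} ∩
          ⋂ j : ℤ, ⋂ _ : |j| ≤ i, {z | |(z.1.w j : ℝ) - z.2.w j| ≤ 1 / ((i : ℝ) + 1)})) := by
    ext z
    simp only [mem_inter_iff, mem_iInter]
    rfl
  rw [e]
  refine IsClosed.inter ?_ (IsClosed.inter ?_ (IsClosed.inter ?_ ?_))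
  · exact isClosed_eq (hk.comp (Xt.cκ.comp c1)) (hk.comp (Xt.cκ.comp c2))
  · refine isClosed_iInter fun j => isClosed_iInter fun _ => ?_
    exact isClosed_eq ((continuous_apply j).comp (Xt.cx.comp c1))
      ((continuous_apply j).comp (Xt.cx.comp c2))
  · exact isClosed_le ((Xt.cr.comp c1).sub (Xt.cr.comp c2)).abs continuous_const
  · refine isClosed_iInter fun j => isClosed_iInter fun _ => ?_
    have h1 : Continuous fun z : Xt a s × Xt a s => (z.1.w j : ℝ) :=
      continuous_subtype_val.comp ((continuous_apply j).comp (Xt.cw.comp c1))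
    have h2 : Continuous fun z : Xt a s × Xt a s => (z.2.w j : ℝ) :=
      continuous_subtype_val.comp ((continuous_apply j).comp (Xt.cw.comp c2))
    exact isClosed_le (h1.sub h2).abs continuous_const

lemma clo_dist [T2Space A] [CompactSpace A] [SecondCountableTopology A] {ε : ℝ} (hε : 0 < ε) :
    ∃ i : ℕ, ∀ p p' : Xt a s, p.r ∈ Icc (-1) 2 → p'.r ∈ Icc (-1) 2 → Clo i p p' →
      dist (q p) (q p') < ε := by
  let D : Set (Xt a s × Xt a s) := ({p : Xt a s | p.r ∈ Icc (-1) 2} ×ˢ {p : Xt a s | p.r ∈ Icc (-1) 2}) ∩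
    {z | ε ≤ dist (q z.1) (q z.2)}
  have hc : Continuous fun z : Xt a s × Xt a s => dist (q z.1) (q z.2) :=
    (cq.comp continuous_fst).dist (cq.comp continuous_snd)
  have hD : IsCompact D := ((Xt.isCompact_slab (-1) 2).prod (Xt.isCompact_slab (-1) 2)).inter_right
    (isClosed_le continuous_const hc)
  obtain ⟨i, hi⟩ := hD.elim_directed_cover (fun i : ℕ => {z : Xt a s × Xt a s | Clo i z.1 z.2}ᶜ)
    (fun i => (isClosed_Clo i).isOpen_compl) (by
      rintro ⟨p, p'⟩ ⟨_, hz⟩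
      by_contra hcon
      simp only [mem_iUnion, not_exists, mem_compl_iff, not_not] at hcon
      have e : p = p' := Clo.eq hcon
      subst e
      change ε ≤ dist (q p) (q p) at hz
      rw [dist_self] at hz
      linarith) (by
      refine Monotone.directed_le ?_
      intro i j hij
      exact compl_subset_compl.mpr fun z hz => Clo.mono hij hz)
  refine ⟨i, fun p p' h1 h2 h3 => ?_⟩
  by_contra hcon
  push Not at hcon
  exact hi (show (p, p') ∈ D from ⟨⟨h1, h2⟩, hcon⟩) h3

lemma traj [T2Space A] [CompactSpace A] [SecondCountableTopology A] (hs : 0 < s) {ε : ℝ} {i : ℕ}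
    (hi : ∀ p p' : Xt a s, p.r ∈ Icc (-1) 2 → p'.r ∈ Icc (-1) 2 → Clo i p p' →
      dist (q p) (q p') < ε) {p p' : Xt a s} (hp : p.r ∈ Ico 0 1) (hp' : p'.r ∈ Ico 0 1) (n : ℕ)
    (hκ : p.κ.1 i = p'.κ.1 i)
    (hx : ∀ m : ℤ, -(i : ℤ) ≤ m → (m : ℝ) ≤ i + 1 + n * s → p.x m = p'.x m)
    (hr : |p.r - p'.r| ≤ 1 / ((i : ℝ) + 1))
    (hw : ∀ j : ℤ, -(i : ℤ) ≤ j → j ≤ n + i → |(p.w j : ℝ) - p'.w j| ≤ 1 / ((i : ℝ) + 1))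
    (j : ℕ) (hj : j < n) : dist ((⇑(TH a s))^[j] (q p)) ((⇑(TH a s))^[j] (q p')) < ε := by
  set m := ⌊p.r + j * s⌋ with hm
  have h1 : (m : ℝ) ≤ p.r + j * s := Int.floor_le _
  have h2 : p.r + j * s < m + 1 := Int.lt_floor_add_one _
  have hjs : 0 ≤ (j : ℝ) * s := by positivity
  have hm0 : 0 ≤ m := Int.floor_nonneg.mpr (by have := hp.1; linarith)
  have hjn : (j : ℝ) * s ≤ n * s := by
    have : (j : ℝ) ≤ n := by exact_mod_cast hj.le
    gcongr
  rw [TH_iter, TH_iter, TT_q, TT_q, ← q_act m, ← q_act m _ p']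
  have e1 := hp.1
  have e2 := hp.2
  have e3 := hp'.1
  have e4 := hp'.2
  apply hi
  · rw [Xt.r_act]; push_cast; constructor <;> linarith
  · rw [Xt.r_act]; push_cast; constructor <;> linarith
  · refine ⟨?_, ?_, ?_, ?_⟩
    · rw [Xt.κ_act, Xt.κ_act, coord_add_int, coord_add_int, hκ]
    · intro l hl
      rw [abs_le] at hl
      rw [Xt.x_act, Xt.x_act]
      apply hx
      · omega
      · have : (l : ℝ) ≤ i := by exact_mod_cast hl.2
        push_cast; linarith
    · rw [Xt.r_act, Xt.r_act]
      convert hr using 2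
      ring
    · intro l hl
      rw [abs_le] at hl
      rw [Xt.w_act, Xt.w_act]
      apply hw <;> omega

lemma near_sing {κ : Odo} {ρ : ℝ} {K : ℕ} (h : DD κ ρ < (1 / 2 : ℝ) ^ K * (s / (8 * pp K))) :
    ∃ b : ℤ, |(res K κ : ℝ) + ρ - pp K * b| < s / 8 := by
  have hp : (0 : ℝ) < pp K := by exact_mod_cast pp_pos K
  have h1 := (DD_ge κ ρ K).trans_lt h
  have h2 : ‖tc K κ ρ‖ < s / (8 * pp K) := lt_of_mul_lt_mul_left h1 (by positivity)
  have e : tc K κ ρ = ((((res K κ : ℝ) + ρ) / pp K : ℝ) : UnitAddCircle) := by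
    unfold tc res
    rw [ZMod.toAddCircle_apply, add_div, AddCircle.coe_add]
  rw [e, UnitAddCircle.norm_eq] at h2
  refine ⟨round (((res K κ : ℝ) + ρ) / pp K), ?_⟩
  have e2 : (res K κ : ℝ) + ρ - pp K * round (((res K κ : ℝ) + ρ) / pp K) =
      pp K * (((res K κ : ℝ) + ρ) / pp K - round (((res K κ : ℝ) + ρ) / pp K)) := by
    field_simp
  rw [e2, abs_mul, abs_of_pos hp]
  calc _ < pp K * (s / (8 * pp K)) := by gcongr
    _ = s / 8 := by field_simp

/-- index of the special fibre coordinate -/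
noncomputable def jj (s : ℝ) (K : ℕ) (R : ℕ) (p : Xt a s) (b : ℤ) : ℤ :=
  round (((pp K : ℝ) * b - res K p.κ - (⌊p.r * R⌋₊ : ℝ) / R) / s)

lemma jj_eq (hs : 0 < s) {K R : ℕ} {p : Xt a s} (hp : 0 ≤ p.r) (hR : 0 < R) (hR2 : 1 / (R : ℝ) < s / 8)
    {b j : ℤ} (h : |(res K p.κ : ℝ) + (p.r + j * s) - pp K * b| < s / 4) : jj s K R p b = j := by
  have hR' : (0 : ℝ) < R := by exact_mod_cast hR
  have h1 := Nat.floor_le (a := p.r * R) (by positivity)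
  have h2 := Nat.lt_floor_add_one (p.r * R)
  have h3 : (⌊p.r * R⌋₊ : ℝ) / R ≤ p.r := by rw [div_le_iff₀ hR']; exact h1
  have h4 : p.r < (⌊p.r * R⌋₊ : ℝ) / R + 1 / R := by rw [← add_div, lt_div_iff₀ hR']; exact h2
  rw [abs_lt] at h
  unfold jj
  rw [round_eq, Int.floor_eq_iff]
  have e : ((pp K : ℝ) * b - res K p.κ - (⌊p.r * R⌋₊ : ℝ) / R) / s + 1 / 2 =
    ((pp K : ℝ) * b - res K p.κ - (⌊p.r * R⌋₊ : ℝ) / R + s / 2) / s := by field_simp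
  rw [e, le_div_iff₀ hs, div_lt_iff₀ hs]
  constructor <;> nlinarith

/-- finite index window -/
noncomputable def II (s : ℝ) (C K n : ℕ) : Finset ℤ :=
  Finset.Icc (-(C : ℤ)) (C + ⌊(n : ℝ) * s / pp K⌋)

lemma mem_II {C K n : ℕ} {b : ℤ} (h1 : -(C : ℝ) ≤ b) (h2 : (b : ℝ) ≤ C + n * s / pp K) : b ∈ II s C K n := by
  unfold II
  rw [Finset.mem_Icc]
  constructor
  · exact_mod_cast h1
  · have : b - C ≤ ⌊(n : ℝ) * s / pp K⌋ := by
      rw [Int.le_floor]; push_cast; linarith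
    linarith

lemma card_II (hs : 0 < s) (C K n : ℕ) : ((II s C K n).card : ℝ) ≤ 2 * C + 1 + n * s / pp K := by
  unfold II
  rw [Int.card_Icc]
  have h0 : (0 : ℤ) ≤ ⌊(n : ℝ) * s / pp K⌋ := Int.floor_nonneg.mpr (by positivity)
  have h1 := Int.floor_le ((n : ℝ) * s / pp K)
  have h2 : (((C + ⌊(n : ℝ) * s / pp K⌋ + 1 - -(C : ℤ)).toNat : ℤ) : ℝ) =
      ((C + ⌊(n : ℝ) * s / pp K⌋ + 1 - -(C : ℤ) : ℤ) : ℝ) := by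
    rw [Int.toNat_of_nonneg (by omega)]
  rw [Int.cast_natCast] at h2
  rw [h2]
  push_cast
  linarith

/-- the code of a point -/
noncomputable def code (s : ℝ) (i K K' R C n : ℕ) (p : Xt a s) :
    ZMod (pp K') × ℕ × (II s C K n × HH K → A) × (II s C K n → ℕ) :=
  (p.κ.1 K', ⌊p.r * R⌋₊, fun z => p.x (pp K * (z.1 : ℤ) + ((z.2 : ℕ) : ℤ) - res K p.κ),
    fun b => ⌊(p.w (jj s K R p b) : ℝ) * (i + 1)⌋₊)

lemma floor_close {u v c : ℝ} (hu : 0 ≤ u) (hv : 0 ≤ v) (hc : 0 < c) (h : ⌊u * c⌋₊ = ⌊v * c⌋₊) :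
    |u - v| < 1 / c := by
  have h1 := Nat.floor_le (a := u * c) (by positivity)
  have h2 := Nat.lt_floor_add_one (u * c)
  have h3 := Nat.floor_le (a := v * c) (by positivity)
  have h4 := Nat.lt_floor_add_one (v * c)
  rw [h] at h1 h2
  rw [lt_div_iff₀ hc, ← abs_of_pos hc, ← abs_mul, abs_lt]
  constructor <;> nlinarith

lemma code_x {i K K' R C n : ℕ} (hs : 0 < s) (hK : K ≤ K') (hC : (i : ℝ) + i * s + s + 5 ≤ C)
    {p p' : Xt a s} (h : code s i K K' R C n p = code s i K K' R C n p') (m : ℤ) (h1 : -(i : ℤ) ≤ m)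
    (h2 : (m : ℝ) ≤ i + 1 + n * s) : p.x m = p'.x m := by
  have hκ : p.κ.1 K' = p'.κ.1 K' := congrArg Prod.fst h
  have hκK := eq_of_le hκ hK
  have hres : res K p.κ = res K p'.κ := res_congr hκ hK
  have hc : ∀ z : II s C K n × HH K, p.x (pp K * (z.1 : ℤ) + ((z.2 : ℕ) : ℤ) - res K p.κ) =
      p'.x (pp K * (z.1 : ℤ) + ((z.2 : ℕ) : ℤ) - res K p'.κ) :=
    fun z => congrFun (congrArg (fun c => c.2.2.1) h) z
  have hpz : (0 : ℤ) < pp K := by exact_mod_cast pp_pos K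
  have hp1 : (1 : ℝ) ≤ pp K := by exact_mod_cast pp_pos K
  set b := (m + res K p.κ) / (pp K : ℤ) with hb
  obtain ⟨t, ht⟩ := Int.eq_ofNat_of_zero_le (Int.emod_nonneg (m + res K p.κ) hpz.ne')
  have ht2 := Int.emod_lt_of_pos (m + res K p.κ) hpz
  have hdm := Int.mul_ediv_add_emod (m + res K p.κ) (pp K : ℤ)
  rw [ht] at ht2 hdm
  rw [← hb] at hdm
  have htp : t < pp K := by exact_mod_cast ht2
  have hm : m = pp K * b + t - res K p.κ := by linarith
  have hmR : (m : ℝ) = pp K * b + t - res K p.κ := by rw [hm]; push_cast; ring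
  by_cases hH : t ∈ HH K
  · have hrl : (res K p.κ : ℝ) < pp K := by exact_mod_cast res_lt K p.κ
    have htl : (t : ℝ) < pp K := by exact_mod_cast htp
    have hr0 : (0 : ℝ) ≤ res K p.κ := by positivity
    have ht0 : (0 : ℝ) ≤ t := by positivity
    have hi0 : (0 : ℝ) ≤ i := by positivity
    have his : (0 : ℝ) ≤ i * s := by positivity
    have h1R : -(i : ℝ) ≤ m := by exact_mod_cast h1
    have hbI : b ∈ II s C K n := by
      apply mem_II
      · have e : -((i : ℝ) + 1) * pp K ≤ b * pp K := by nlinarith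
        have := le_of_mul_le_mul_right e (by linarith)
        linarith
      · have e : (b : ℝ) * pp K ≤ (i + 2) * pp K + n * s := by nlinarith
        have e2 : (b : ℝ) ≤ ((i + 2) * pp K + n * s) / pp K := by
          rw [le_div_iff₀ (by linarith)]; exact e
        rw [add_div, mul_div_cancel_right₀ _ (by linarith)] at e2
        linarith
    have := hc (⟨b, hbI⟩, ⟨t, hH⟩)
    simp only at this
    rw [← hres, ← hm] at this
    exact this
  · rw [mem_HH] at hH
    push Not at hH
    obtain ⟨k, hk, hB⟩ := hH htp
    have e1 : (p.κ + (m : Odo)).1 K = ((t : ℤ) : Odo).1 K := by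
      rw [coord_add_int, coord_int, hm]
      push_cast
      simp [res]
    have e2 : (p.κ + (m : Odo)).1 K = (p'.κ + (m : Odo)).1 K := by
      rw [coord_add_int, coord_add_int, hκK]
    rw [← Bad_congr e1 hk] at hB
    obtain ⟨l, hl, hF⟩ := FB_of_bad hB
    have hlK : l < K := by omega
    rw [p.sym m l hF, p'.sym m l ((FB_congr e2 hlK).mp hF), bv_congr a e2 hlK]

lemma code_w {i K K' R C n K1 : ℕ} {δ : ℝ} (hs : 0 < s) (hK : K ≤ K') (hK1 : K1 ≤ K')
    (hC : (i : ℝ) + i * s + s + 5 ≤ C)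
    (hg : ∀ (κ κ' : Odo) (r r' : ℝ), κ.1 K1 = κ'.1 K1 → |r - r'| < δ →
      (1 / 2 : ℝ) ^ K * (s / (8 * pp K)) ≤ DD κ r → (1 / 2 : ℝ) ^ K * (s / (8 * pp K)) ≤ DD κ' r' →
        |gg κ r - gg κ' r'| < 1 / ((i : ℝ) + 1))
    (hR : 0 < R) (hR1 : 1 / (R : ℝ) < s / 8) (hR2 : 1 / (R : ℝ) < δ)
    {p p' : Xt a s} (hp : p.r ∈ Ico 0 1) (hp' : p'.r ∈ Ico 0 1)
    (h : code s i K K' R C n p = code s i K K' R C n p') (j : ℤ) (h1 : -(i : ℤ) ≤ j)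
    (h2 : j ≤ n + i) : |(p.w j : ℝ) - p'.w j| ≤ 1 / ((i : ℝ) + 1) := by
  have hκ : p.κ.1 K' = p'.κ.1 K' := congrArg Prod.fst h
  have hres : res K p.κ = res K p'.κ := res_congr hκ hK
  have hfl : ⌊p.r * R⌋₊ = ⌊p'.r * R⌋₊ := congrArg (fun c => c.2.1) h
  have hR' : (0 : ℝ) < R := by exact_mod_cast hR
  have hrr := floor_close hp.1 hp'.1 hR' hfl
  have hc : ∀ b : II s C K n, ⌊(p.w (jj s K R p b) : ℝ) * (i + 1)⌋₊ =
      ⌊(p'.w (jj s K R p' b) : ℝ) * (i + 1)⌋₊ :=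
    fun b => congrFun (congrArg (fun c => c.2.2.2) h) b
  have hpos : 0 < (1 / 2 : ℝ) ^ K * (s / (8 * pp K)) := by
    have : (0 : ℝ) < pp K := by exact_mod_cast pp_pos K
    positivity
  have fin : ∀ b : ℤ, |(res K p.κ : ℝ) + (p.r + j * s) - pp K * b| < s / 4 →
      |(res K p'.κ : ℝ) + (p'.r + j * s) - pp K * b| < s / 4 →
      |(p.w j : ℝ) - p'.w j| ≤ 1 / ((i : ℝ) + 1) := by
    intro b hb hb'
    have e1 := jj_eq hs hp.1 hR hR1 hb
    have e2 := jj_eq hs hp'.1 hR hR1 hb'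
    have hbI : b ∈ II s C K n := by
      rw [abs_lt] at hb
      have hp1 : (1 : ℝ) ≤ pp K := by exact_mod_cast pp_pos K
      have hrl : (res K p.κ : ℝ) < pp K := by exact_mod_cast res_lt K p.κ
      have hr0 : (0 : ℝ) ≤ res K p.κ := by positivity
      have hi0 : (0 : ℝ) ≤ i := by positivity
      have his : (0 : ℝ) ≤ i * s := by positivity
      have h1R : -(i : ℝ) ≤ j := by exact_mod_cast h1
      have h2R : (j : ℝ) ≤ n + i := by exact_mod_cast h2
      have j1 := mul_le_mul_of_nonneg_right h1R hs.le
      have j2 := mul_le_mul_of_nonneg_right h2R hs.le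
      have f1 := hp.1
      have f2 := hp.2
      apply mem_II
      · rcases le_or_gt 0 b with h0 | h0
        · have : (0 : ℝ) ≤ b := by exact_mod_cast h0
          linarith
        · have : (b : ℝ) ≤ 0 := by exact_mod_cast h0.le
          nlinarith
      · have e : (b : ℝ) * pp K ≤ (i * s + s + 2) * pp K + n * s := by nlinarith
        have e2 : (b : ℝ) ≤ ((i * s + s + 2) * pp K + n * s) / pp K := by
          rw [le_div_iff₀ (by linarith)]; exact e
        rw [add_div, mul_div_cancel_right₀ _ (by linarith)] at e2
        linarith
    have := hc ⟨b, hbI⟩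
    simp only at this
    rw [e1, e2] at this
    exact (floor_close (p.w j).2.1 (p'.w j).2.1 (by positivity) this).le
  by_cases hd : (1 / 2 : ℝ) ^ K * (s / (8 * pp K)) ≤ DD p.κ (p.r + j * s)
  · by_cases hd' : (1 / 2 : ℝ) ^ K * (s / (8 * pp K)) ≤ DD p'.κ (p'.r + j * s)
    · rw [p.weq j (hpos.trans_le hd).ne', p'.weq j]
      · refine (hg _ _ _ _ (eq_of_le hκ hK1) ?_ hd hd').le
        rw [add_sub_add_right_eq_sub]
        exact hrr.trans hR2
      · exact (hpos.trans_le hd').ne'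
    · push Not at hd'
      obtain ⟨b, hb⟩ := near_sing hd'
      refine fin b ?_ (by linarith)
      rw [abs_lt] at hb hrr ⊢
      rw [hres]
      constructor <;> linarith
  · push Not at hd
    obtain ⟨b, hb⟩ := near_sing hd
    refine fin b (by linarith) ?_
    rw [abs_lt] at hb hrr ⊢
    rw [← hres]
    constructor <;> linarith

end up
end Slov


set_option linter.unusedSectionVars false
set_option linter.unusedVariables false

namespace Slov

section up2
variable {A : Type} [TopologicalSpace A] {a : ℕ → A} {s : ℝ}
variable [T2Space A] [CompactSpace A] [SecondCountableTopology A]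

lemma sep_upper [Fintype A] (hs : 0 < s) {ε : ℝ} {i : ℕ}
    (hi : ∀ p p' : Xt a s, p.r ∈ Icc (-1) 2 → p'.r ∈ Icc (-1) 2 → Clo i p p' →
      dist (q p) (q p') < ε) (K : ℕ) : ∃ P C : ℕ, 0 < P ∧ ∀ (n : ℕ) (Z : Set (XX a s)),
        sepNum (⇑(TH a s)) n ε Z ≤ P * (Fintype.card A ^ (HH K).card * (i + 2)) ^ (II s C K n).card := by
  classical
  have hpos : 0 < (1 / 2 : ℝ) ^ K * (s / (8 * pp K)) := by
    have : (0 : ℝ) < pp K := by exact_mod_cast pp_pos K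
    positivity
  obtain ⟨K1, δ, hδ, hg⟩ := gg_unif hpos (show (0 : ℝ) < 1 / ((i : ℝ) + 1) by positivity)
  obtain ⟨C, hC⟩ := exists_nat_ge ((i : ℝ) + i * s + s + 5)
  obtain ⟨R0, hR0⟩ := exists_nat_one_div_lt
    (show (0 : ℝ) < min (min (s / 8) δ) (1 / ((i : ℝ) + 1)) by positivity)
  set R := R0 + 1 with hR
  have hRc : 1 / (R : ℝ) < min (min (s / 8) δ) (1 / ((i : ℝ) + 1)) := by
    rw [hR]; push_cast; exact hR0
  have hR1 : 1 / (R : ℝ) < s / 8 := hRc.trans_le ((min_le_left _ _).trans (min_le_left _ _))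
  have hR2 : 1 / (R : ℝ) < δ := hRc.trans_le ((min_le_left _ _).trans (min_le_right _ _))
  have hR3 : 1 / (R : ℝ) < 1 / ((i : ℝ) + 1) := hRc.trans_le (min_le_right _ _)
  have hRpos : 0 < R := by omega
  have hR' : (0 : ℝ) < R := by exact_mod_cast hRpos
  obtain ⟨K', hk1, hk2, hk3⟩ : ∃ K', K ≤ K' ∧ K1 ≤ K' ∧ i ≤ K' :=
    ⟨K + K1 + i, by omega, by omega, by omega⟩
  refine ⟨pp K' * R, C, Nat.mul_pos (pp_pos _) hRpos, fun n Z => ?_⟩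
  refine csSup_le' ?_
  rintro m ⟨E, _, hE, rfl⟩
  choose rep hrep1 hrep2 using fun y : XX a s => exists_rep y 0
  simp only [zero_add] at hrep2
  let F : Finset (ZMod (pp K') × ℕ × (II s C K n × HH K → A) × (II s C K n → ℕ)) :=
    Finset.univ ×ˢ (Finset.range R ×ˢ (Finset.univ ×ˢ
      Fintype.piFinset (fun _ => Finset.range (i + 2))))
  have hF : F.card = pp K' * R * (Fintype.card A ^ (HH K).card * (i + 2)) ^ (II s C K n).card := by
    simp only [F, Finset.card_product, Finset.card_univ, Finset.card_range, Fintype.card_piFinset,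
      Finset.prod_const, ZMod.card, Fintype.card_fun, Fintype.card_prod, Fintype.card_coe]
    rw [mul_pow, ← pow_mul, mul_comm (HH K).card]
    ring
  rw [← hF]
  refine Finset.card_le_card_of_injOn (fun y => code s i K K' R C n (rep y)) ?_ ?_
  · intro y _
    have h1 := (hrep2 y).1
    have h2 := (hrep2 y).2
    simp only [F, code, Finset.mem_coe, Finset.mem_product, Finset.mem_univ, true_and,
      Finset.mem_range, Fintype.mem_piFinset]
    refine ⟨?_, fun b => ?_⟩
    · rw [Nat.floor_lt (by positivity)]; nlinarith
    · rw [Nat.floor_lt (by have := ((rep y).w (jj s K R (rep y) b)).2.1; positivity)]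
      have := ((rep y).w (jj s K R (rep y) b)).2.2
      have h0 : (0 : ℝ) ≤ i := by positivity
      push_cast
      nlinarith
  · intro y hy y' hy' he
    by_contra hne
    obtain ⟨j, hj, hd⟩ := hE y hy y' hy' hne
    have he' : code s i K K' R C n (rep y) = code s i K K' R C n (rep y') := he
    have hκ : (rep y).κ.1 K' = (rep y').κ.1 K' := congrArg Prod.fst he'
    have hfl : ⌊(rep y).r * R⌋₊ = ⌊(rep y').r * R⌋₊ := congrArg (fun c => c.2.1) he'
    have hrr := floor_close (hrep2 y).1 (hrep2 y').1 hR' hfl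
    have := traj hs hi (hrep2 y) (hrep2 y') n (eq_of_le hκ hk3) (code_x hs hk1 hC he')
      (hrr.trans hR3).le (code_w hs hk1 hk2 hC hg hRpos hR1 hR2 (hrep2 y) (hrep2 y') he') j hj
    rw [hrep1, hrep1] at this
    linarith

theorem entropy_upper [Fintype A] [Nonempty A] (hs : 0 < s) :
    dynEntropy (⇑(TH a s)) ≤ ((s / 2 * Real.log (Fintype.card A) : ℝ) : EReal) := by
  unfold dynEntropy
  refine iSup₂_le fun Z _ => ?_
  unfold entropyOnSet
  refine iSup₂_le fun ε hε => ?_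
  obtain ⟨i, hi⟩ := clo_dist (a := a) (s := s) hε
  have hcard : (1 : ℝ) ≤ Fintype.card A := by exact_mod_cast Fintype.card_pos
  have hlog : 0 ≤ Real.log (Fintype.card A) := Real.log_nonneg hcard
  have hlogi : 0 ≤ Real.log ((i : ℝ) + 2) := Real.log_nonneg (by
    have : (0 : ℝ) ≤ i := by positivity
    linarith)
  have hpp : Tendsto (fun K => (pp K : ℝ)) atTop atTop :=
    tendsto_natCast_atTop_atTop.comp pp_strictMono.tendsto_atTop
  have hK : ∀ K : ℕ, (atTop.limsup fun n : ℕ => ((Real.log (sepNum (⇑(TH a s)) n ε Z) / n : ℝ) : EReal)) ≤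
      ((s * ((HH K).card / pp K * Real.log (Fintype.card A) + Real.log ((i : ℝ) + 2) * (pp K : ℝ)⁻¹) : ℝ) : EReal) := by
    intro K
    obtain ⟨P, C, hP, h⟩ := sep_upper hs hi K
    set Q : ℝ := (HH K).card * Real.log (Fintype.card A) + Real.log ((i : ℝ) + 2) with hQ
    have hQ0 : 0 ≤ Q := by positivity
    have hP1 : (1 : ℝ) ≤ P := by exact_mod_cast hP
    have hp : (0 : ℝ) < pp K := by exact_mod_cast pp_pos K
    have hb : ∀ n : ℕ, 1 ≤ n → Real.log (sepNum (⇑(TH a s)) n ε Z) / n ≤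
        (Real.log P + (2 * C + 1) * Q) * (n : ℝ)⁻¹ + s / pp K * Q := by
      intro n hn
      have hn' : (0 : ℝ) < n := by exact_mod_cast hn
      have e1 : Real.log (sepNum (⇑(TH a s)) n ε Z) ≤ Real.log P + (II s C K n).card * Q := by
        rcases Nat.eq_zero_or_pos (sepNum (⇑(TH a s)) n ε Z) with h0 | h0
        · rw [h0]; simp only [Nat.cast_zero, Real.log_zero]
          have := Real.log_nonneg hP1
          positivity
        · have e2 : (sepNum (⇑(TH a s)) n ε Z : ℝ) ≤
              P * ((Fintype.card A : ℝ) ^ (HH K).card * ((i : ℝ) + 2)) ^ (II s C K n).card := by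
            exact_mod_cast h n Z
          refine (Real.log_le_log (by exact_mod_cast h0) e2).trans (le_of_eq ?_)
          have h3 : (0 : ℝ) < (Fintype.card A : ℝ) ^ (HH K).card := by positivity
          rw [Real.log_mul (by positivity) (by positivity), Real.log_pow,
            Real.log_mul (by positivity) (by positivity), Real.log_pow]
      have e3 := mul_le_mul_of_nonneg_right (card_II hs C K n) hQ0
      rw [div_le_iff₀ hn']
      have e4 : ((Real.log P + (2 * C + 1) * Q) * (n : ℝ)⁻¹ + s / pp K * Q) * n =
          Real.log P + (2 * C + 1 + n * s / pp K) * Q := by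
        field_simp
        ring
      rw [e4]
      linarith
    have hlim : Tendsto (fun n : ℕ => (((Real.log P + (2 * C + 1) * Q) * (n : ℝ)⁻¹ + s / pp K * Q : ℝ) : EReal))
        atTop (𝓝 (((Real.log P + (2 * C + 1) * Q) * 0 + s / pp K * Q : ℝ) : EReal)) := by
      refine (continuous_coe_real_ereal.tendsto _).comp ?_
      exact ((tendsto_inv_atTop_nhds_zero_nat (𝕜 := ℝ)).const_mul _).add_const _
    have e5 : s * ((HH K).card / pp K * Real.log (Fintype.card A) + Real.log ((i : ℝ) + 2) * (pp K : ℝ)⁻¹) =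
        (Real.log P + (2 * C + 1) * Q) * 0 + s / pp K * Q := by
      rw [hQ]; field_simp; ring
    rw [e5, ← hlim.limsup_eq]
    refine limsup_le_limsup ?_
    filter_upwards [eventually_ge_atTop 1] with n hn
    exact EReal.coe_le_coe_iff.mpr (hb n hn)
  have hlim : Tendsto (fun K : ℕ => ((s * ((HH K).card / pp K * Real.log (Fintype.card A) +
      Real.log ((i : ℝ) + 2) * (pp K : ℝ)⁻¹) : ℝ) : EReal)) atTop
      (𝓝 ((s * (1 / 2 * Real.log (Fintype.card A) + Real.log ((i : ℝ) + 2) * 0) : ℝ) : EReal)) := by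
    refine (continuous_coe_real_ereal.tendsto _).comp ?_
    exact ((card_HH_tendsto.mul_const _).add (hpp.inv_tendsto_atTop.const_mul _)).const_mul _
  have e : s / 2 * Real.log (Fintype.card A) =
      s * (1 / 2 * Real.log (Fintype.card A) + Real.log ((i : ℝ) + 2) * 0) := by ring
  rw [e]
  exact ge_of_tendsto' hlim hK

end up2
end Slov


set_option linter.unusedSectionVars false
set_option linter.unusedVariables false

namespace Slov

lemma final_of {A : Type} [TopologicalSpace A] [T2Space A] [CompactSpace A]
    [SecondCountableTopology A] {a : ℕ → A} {s : ℝ} (ha : DenseRange a) (hs : 0 < s)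
    (hi : Irrational s) {t : EReal} (ht : dynEntropy (⇑(TH a s)) = t) :
    ∃ (X : Type) (_ : MetricSpace X), CompactSpace X ∧
      (∃ a b c : X, a ≠ b ∧ a ≠ c ∧ b ≠ c) ∧
      ∃ T : X ≃ₜ X, IsMinimal ⇑T ∧ (∀ S : X ≃ₜ X, ∃ n : ℤ, S = hzpow T n) ∧
        dynEntropy ⇑T = t := by
  refine ⟨XX a s, instMetricXX a s, inferInstance, ?_, TH a s, minimal_TH ha hs hi,
    rigid_TH ha hs hi, ht⟩
  have hne : ∀ r r' : ℝ, r ≠ r' → q (gen a s r) ≠ q (gen a s r') := by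
    intro r r' h he
    exact h (congrArg Xt.r (q_inj0 he rfl rfl))
  exact ⟨_, _, _, hne 0 1 (by norm_num), hne 0 2 (by norm_num), hne 1 2 (by norm_num)⟩

lemma final_fin (N : ℕ) [NeZero N] {s : ℝ} (hs : 0 < s) (hi : Irrational s) {t : EReal}
    (ht : ((s / 2 * Real.log N : ℝ) : EReal) = t) :
    ∃ (X : Type) (_ : MetricSpace X), CompactSpace X ∧
      (∃ a b c : X, a ≠ b ∧ a ≠ c ∧ b ≠ c) ∧
      ∃ T : X ≃ₜ X, IsMinimal ⇑T ∧ (∀ S : X ≃ₜ X, ∃ n : ℤ, S = hzpow T n) ∧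
        dynEntropy ⇑T = t := by
  have ha : Function.Surjective (fun n : ℕ => Fin.ofNat N n) := by
    intro i
    exact ⟨i, by simp⟩
  refine final_of (a := fun n : ℕ => Fin.ofNat N n) ha.denseRange hs hi ?_
  rw [← ht]
  apply le_antisymm
  · have := entropy_upper (a := fun n : ℕ => Fin.ofNat N n) hs
    rw [Fintype.card_fin] at this
    exact this
  · have := entropy_lower (a := fun n : ℕ => Fin.ofNat N n) hs Finset.univ
      (Finset.univ_nonempty)
    rw [Finset.card_univ, Fintype.card_fin] at this
    exact this

lemma final_top :
    ∃ (X : Type) (_ : MetricSpace X), CompactSpace X ∧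
      (∃ a b c : X, a ≠ b ∧ a ≠ c ∧ b ≠ c) ∧
      ∃ T : X ≃ₜ X, IsMinimal ⇑T ∧ (∀ S : X ≃ₜ X, ∃ n : ℤ, S = hzpow T n) ∧
        dynEntropy ⇑T = (⊤ : EReal) := by
  have hs : 0 < √(2 : ℝ) := by positivity
  refine final_of (a := TopologicalSpace.denseSeq (ℕ → Bool)) (TopologicalSpace.denseRange_denseSeq _)
    hs irrational_sqrt_two ?_
  rw [EReal.eq_top_iff_forall_lt]
  intro y
  have h1 : Tendsto (fun N : ℕ => √2 / 2 * Real.log (N : ℝ)) atTop atTop :=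
    (Real.tendsto_log_atTop.comp tendsto_natCast_atTop_atTop).const_mul_atTop (by positivity)
  obtain ⟨N, hN, hN1⟩ := ((h1.eventually_gt_atTop y).and (eventually_ge_atTop 1)).exists
  obtain ⟨S, hS⟩ := Infinite.exists_subset_card_eq (ℕ → Bool) N
  have := entropy_lower (a := TopologicalSpace.denseSeq (ℕ → Bool)) hs S
    (Finset.card_pos.mp (by omega))
  rw [hS] at this
  exact lt_of_lt_of_le (EReal.coe_lt_coe_iff.mpr hN) this

lemma irr_choice {u : ℝ} (hu : 0 < u) :
    Irrational (2 * u / Real.log 2) ∨ Irrational (2 * u / Real.log 3) := by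
  have l2 : 0 < Real.log 2 := Real.log_pos (by norm_num)
  have l3 : 0 < Real.log 3 := Real.log_pos (by norm_num)
  by_contra hc
  push Not at hc
  obtain ⟨h1, h2⟩ := hc
  unfold Irrational at h1 h2
  push Not at h1 h2
  obtain ⟨x, hx⟩ := h1
  obtain ⟨y, hy⟩ := h2
  have hx0 : 0 < x := by
    have : (0 : ℝ) < x := by rw [hx]; positivity
    exact_mod_cast this
  have hy0 : 0 < y := by
    have : (0 : ℝ) < y := by rw [hy]; positivity
    exact_mod_cast this
  have e : (x : ℝ) * Real.log 2 = y * Real.log 3 := by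
    rw [hx, hy]; field_simp
  obtain ⟨m, hm⟩ := Int.eq_ofNat_of_zero_le (Rat.num_nonneg.mpr hx0.le)
  obtain ⟨n, hn⟩ := Int.eq_ofNat_of_zero_le (Rat.num_nonneg.mpr hy0.le)
  have hx1 : (x : ℝ) = m / x.den := by
    rw [Rat.cast_def, hm]; simp
  have hy1 : (y : ℝ) = n / y.den := by
    rw [Rat.cast_def, hn]; simp
  have hxd : (x.den : ℝ) ≠ 0 := by exact_mod_cast x.den_nz
  have hyd : (y.den : ℝ) ≠ 0 := by exact_mod_cast y.den_nz
  rw [hx1, hy1] at e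
  have e2 : ((m * y.den : ℕ) : ℝ) * Real.log 2 = ((n * x.den : ℕ) : ℝ) * Real.log 3 := by
    push_cast
    field_simp at e
    linarith
  rw [← Real.log_pow, ← Real.log_pow] at e2
  have e3 := Real.log_injOn_pos (by simp) (by simp) e2
  have e4 : 2 ^ (m * y.den) = 3 ^ (n * x.den) := by exact_mod_cast e3
  have hm0 : 0 < m := by
    have := Rat.num_pos.mpr hx0
    omega
  have h5 : 2 ∣ 3 ^ (n * x.den) := by
    rw [← e4]; exact dvd_pow_self 2 (Nat.mul_pos hm0 y.den_pos).ne'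
  have := Nat.prime_two.dvd_of_dvd_pow h5
  omega

end Slov

theorem exists_slovak_space_with_entropy (t : EReal) (ht : 0 ≤ t) :
    ∃ (X : Type) (_ : MetricSpace X), CompactSpace X ∧
      (∃ a b c : X, a ≠ b ∧ a ≠ c ∧ b ≠ c) ∧
      ∃ T : X ≃ₜ X, IsMinimal ⇑T ∧ (∀ S : X ≃ₜ X, ∃ n : ℤ, S = hzpow T n) ∧
        dynEntropy ⇑T = t := by
  induction t using EReal.rec with
  | bot => simp at ht
  | top => exact Slov.final_top
  | coe u =>
    have hu : 0 ≤ u := by exact_mod_cast ht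
    rcases hu.eq_or_lt with h0 | h0
    · refine Slov.final_fin 1 (s := √2) (by positivity) irrational_sqrt_two ?_
      rw [← h0]; simp
    · have l2 : 0 < Real.log 2 := Real.log_pos (by norm_num)
      have l3 : 0 < Real.log 3 := Real.log_pos (by norm_num)
      rcases Slov.irr_choice h0 with h | h
      · refine Slov.final_fin 2 (s := 2 * u / Real.log 2) (by positivity) h ?_
        congr 1
        push_cast
        field_simp
      · refine Slov.final_fin 3 (s := 2 * u / Real.log 3) (by positivity) h ?_
        congr 1
        push_cast
        field_simp
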